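/- For g = sl_n, so_{2n+1}, so_{2n}, or sp_{2n}, let U_{r,s}(n) and U_{r,s}(n^-) be the subalgebras of U_{r,s}(g) generated by the e_i and by the f_i respectively, and let U^0 be the (Laurent polynomial) subalgebra generated by all ω_i^{±1}, ω_i'^{±1}. Then the multiplication map U_{r,s}(n^-) ⊗ U^0 ⊗ U_{r,s}(n) → U_{r,s}(g), x ⊗ h ⊗ y ↦ xhy, is an isomorphism of K-vector spaces (the triangular decomposition of U_{r,s}(g)). -/

import Mathlib

noncomputable section

/-- The four classical families: A (sl), B (so, odd), C (sp), D (so, even). -/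
inductive GT | A | B | C | D
deriving DecidableEq

/-- the rank: n+1 in types A, B, C and n+2 in type D (so that the rank is ≥ 1,
resp. ≥ 2); in type A of rank N the Lie algebra is sl_{N+1}. -/
def rkOf : GT → ℕ → ℕ
  | .D, n => n+2
  | _,  n => n+1

/-- (ε_j, α_i) for the simple roots of the indicated type of rank N (0-indexed):
α_i = ε_i − ε_{i+1} for the non-final indices (all indices in type A), and
α_{N−1} = ε_{N−1} (B), 2ε_{N−1} (C), ε_{N−2} + ε_{N−1} (D). -/
def ipaG (g : GT) (N : ℕ) (j i : ℕ) : ℤ :=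
  if g = .A ∨ i+1 < N then (if j = i then 1 else 0) - (if j = i+1 then 1 else 0)
  else match g with
  | .B => if j+1 = N then 1 else 0
  | .C => if j+1 = N then 2 else 0
  | _ => if j+2 = N ∨ j+1 = N then 1 else 0

/-- (α_i, α_j) -/
def apaG (g : GT) (N : ℕ) (i j : ℕ) : ℤ :=
  ∑ k ∈ Finset.range (N+1), ipaG g N k i * ipaG g N k j

/-- the Cartan matrix a_{ij} = 2(α_i,α_j)/(α_i,α_i) -/
def aG (g : GT) (N : ℕ) (i j : ℕ) : ℤ := 2 * apaG g N i j / apaG g N i i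

/-- d_i, where r_i = r^{d_i}: in type B, r_i = r^{(α_i,α_i)}; otherwise
r_i = r^{(α_i,α_i)/2}. -/
def dG (g : GT) (N : ℕ) (i : ℕ) : ℤ :=
  if g = .B then apaG g N i i else apaG g N i i / 2

section
variable {K : Type*} [Field K]

/-- r_i (resp. s_i with the other parameter) -/
def riG (g : GT) (N : ℕ) (ρ : K) (i : ℕ) : K := ρ ^ (dG g N i)

/-- The structure constants ⟨ω_i', ω_j⟩ of U_{ρ,σ}(g):
for sl: ρ^{(ε_j,α_i)}σ^{(ε_{j+1},α_i)};
for so odd: ρ^{2(ε_j,α_i)}σ^{2(ε_{j+1},α_i)} (j < N−1), ρ^{2(ε_{N−1},α_i)}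
  (i < N−1, j = N−1), ρσ⁻¹ (i = j = N−1);
for sp: ρ^{(ε_j,α_i)}σ^{(ε_{j+1},α_i)} (j < N−1), ρ^{2(ε_{N−1},α_i)} (i < N−1,
  j = N−1), ρ²σ⁻² (i = j = N−1);
for so even: ρ^{(ε_j,α_i)}σ^{(ε_{j+1},α_i)} (j < N−1), ρ^{(ε_{N−2},α_i)}σ^{−(ε_{N−1},α_i)}
  (i ≠ N−2, j = N−1), ρ^{(ε_{N−1},α_{N−2})}σ^{−(ε_{N−2},α_{N−2})} (i = N−2, j = N−1). -/
def cstG (g : GT) (N : ℕ) (ρ σ : K) (i j : ℕ) : K :=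
  match g with
  | .A => ρ^(ipaG .A N j i) * σ^(ipaG .A N (j+1) i)
  | .B => if j+1 < N then ρ^(2 * ipaG .B N j i) * σ^(2 * ipaG .B N (j+1) i)
          else if i+1 < N then ρ^(2 * ipaG .B N (N-1) i)
          else ρ * σ⁻¹
  | .C => if j+1 < N then ρ^(ipaG .C N j i) * σ^(ipaG .C N (j+1) i)
          else if i+1 < N then ρ^(2 * ipaG .C N (N-1) i)
          else ρ^2 * σ^(-2:ℤ)
  | .D => if j+1 < N then ρ^(ipaG .D N j i) * σ^(ipaG .D N (j+1) i)
          else if i+2 ≠ N then ρ^(ipaG .D N (N-2) i) * σ^(-(ipaG .D N (N-1) i))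
          else ρ^(ipaG .D N (N-1) (N-2)) * σ^(-(ipaG .D N (N-2) (N-2)))

/-- generators e_i, f_i, ω_i^{±1}, ω_i'^{±1} -/
inductive Gen (N : ℕ)
  | e (i : Fin N) | f (i : Fin N)
  | w (i : Fin N) | winv (i : Fin N) | wp (i : Fin N) | wpinv (i : Fin N)

def Gen.toral {N : ℕ} : Gen N → Prop
  | .e _ => False
  | .f _ => False
  | _ => True

variable (K) in
abbrev FG (g : GT) (n : ℕ) : Type _ := FreeAlgebra K (Gen (rkOf g n))

/-- ad_l e_i applied to a word (in the free algebra): ad_l e_i (x) = e_i x − ω_i x ω_i⁻¹ e_i. -/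
def adE {g : GT} {n : ℕ} (i : Fin (rkOf g n)) (x : FG K g n) : FG K g n :=
  FreeAlgebra.ι K (Gen.e i) * x
    - FreeAlgebra.ι K (Gen.w i) * x * FreeAlgebra.ι K (Gen.winv i) * FreeAlgebra.ι K (Gen.e i)

/-- ad_r f_i applied to a word: ad_r f_i (x) = x f_i − f_i ω_i'⁻¹ x ω_i'. -/
def adF {g : GT} {n : ℕ} (i : Fin (rkOf g n)) (x : FG K g n) : FG K g n :=
  x * FreeAlgebra.ι K (Gen.f i)
    - FreeAlgebra.ι K (Gen.f i) * FreeAlgebra.ι K (Gen.wpinv i) * x * FreeAlgebra.ι K (Gen.wp i)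

/-- The defining relations of U_{ρ,σ}(g) in the uniform form of Section 2:
all ω_i^{±1}, ω_j'^{±1} commute and are invertible;
ω_j e_i ω_j⁻¹ = ⟨ω_i',ω_j⟩e_i, ω_j f_i ω_j⁻¹ = ⟨ω_i',ω_j⟩⁻¹f_i,
ω_j' e_i ω_j'⁻¹ = ⟨ω_j',ω_i⟩⁻¹e_i, ω_j' f_i ω_j'⁻¹ = ⟨ω_j',ω_i⟩f_i;
[e_i,f_j] = δ_{ij}(ω_i − ω_i')/(r_i − s_i); and the (r,s)-Serre relations
(ad_l e_i)^{1−a_{ij}}(e_j) = 0, (ad_r f_i)^{1−a_{ij}}(f_j) = 0 for i ≠ j. -/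
inductive RelG (g : GT) (n : ℕ) (ρ σ : K) : FG K g n → FG K g n → Prop
  | comm (x y : Gen (rkOf g n)) (hx : x.toral) (hy : y.toral) :
      RelG g n ρ σ (FreeAlgebra.ι K x * FreeAlgebra.ι K y)
        (FreeAlgebra.ι K y * FreeAlgebra.ι K x)
  | winv_r (i : Fin (rkOf g n)) :
      RelG g n ρ σ (FreeAlgebra.ι K (Gen.w i) * FreeAlgebra.ι K (Gen.winv i)) 1
  | winv_l (i : Fin (rkOf g n)) :
      RelG g n ρ σ (FreeAlgebra.ι K (Gen.winv i) * FreeAlgebra.ι K (Gen.w i)) 1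
  | wpinv_r (i : Fin (rkOf g n)) :
      RelG g n ρ σ (FreeAlgebra.ι K (Gen.wp i) * FreeAlgebra.ι K (Gen.wpinv i)) 1
  | wpinv_l (i : Fin (rkOf g n)) :
      RelG g n ρ σ (FreeAlgebra.ι K (Gen.wpinv i) * FreeAlgebra.ι K (Gen.wp i)) 1
  | wE (i j : Fin (rkOf g n)) :
      RelG g n ρ σ
        (FreeAlgebra.ι K (Gen.w j) * FreeAlgebra.ι K (Gen.e i) * FreeAlgebra.ι K (Gen.winv j))
        (cstG g (rkOf g n) ρ σ i j • FreeAlgebra.ι K (Gen.e i))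
  | wF (i j : Fin (rkOf g n)) :
      RelG g n ρ σ
        (FreeAlgebra.ι K (Gen.w j) * FreeAlgebra.ι K (Gen.f i) * FreeAlgebra.ι K (Gen.winv j))
        ((cstG g (rkOf g n) ρ σ i j)⁻¹ • FreeAlgebra.ι K (Gen.f i))
  | wpE (i j : Fin (rkOf g n)) :
      RelG g n ρ σ
        (FreeAlgebra.ι K (Gen.wp j) * FreeAlgebra.ι K (Gen.e i) * FreeAlgebra.ι K (Gen.wpinv j))
        ((cstG g (rkOf g n) ρ σ j i)⁻¹ • FreeAlgebra.ι K (Gen.e i))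
  | wpF (i j : Fin (rkOf g n)) :
      RelG g n ρ σ
        (FreeAlgebra.ι K (Gen.wp j) * FreeAlgebra.ι K (Gen.f i) * FreeAlgebra.ι K (Gen.wpinv j))
        (cstG g (rkOf g n) ρ σ j i • FreeAlgebra.ι K (Gen.f i))
  | ef (i j : Fin (rkOf g n)) :
      RelG g n ρ σ
        (FreeAlgebra.ι K (Gen.e i) * FreeAlgebra.ι K (Gen.f j)
          - FreeAlgebra.ι K (Gen.f j) * FreeAlgebra.ι K (Gen.e i))
        (if i = j then
          (riG g (rkOf g n) ρ i - riG g (rkOf g n) σ i)⁻¹ •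
            (FreeAlgebra.ι K (Gen.w i) - FreeAlgebra.ι K (Gen.wp i))
        else 0)
  | serreE (i j : Fin (rkOf g n)) (h : i ≠ j) :
      RelG g n ρ σ ((adE i)^[(1 - aG g (rkOf g n) i j).toNat] (FreeAlgebra.ι K (Gen.e j))) 0
  | serreF (i j : Fin (rkOf g n)) (h : i ≠ j) :
      RelG g n ρ σ ((adF i)^[(1 - aG g (rkOf g n) i j).toNat] (FreeAlgebra.ι K (Gen.f j))) 0

variable (K) in
/-- the two-parameter quantum group U_{ρ,σ}(g) -/
abbrev UG (g : GT) (n : ℕ) (ρ σ : K) : Type _ := RingQuot (RelG g n ρ σ)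

/-- images of the generators -/
def genG {g : GT} {n : ℕ} (ρ σ : K) (x : Gen (rkOf g n)) : UG K g n ρ σ :=
  RingQuot.mkAlgHom K (RelG g n ρ σ) (FreeAlgebra.ι K x)





/-!
STATEMENT 8.  For g = sl, so_{odd}, so_{even}, or sp, let U_{r,s}(n) and U_{r,s}(n⁻)
be the subalgebras of U_{r,s}(g) generated by the e_i and by the f_i respectively,
and let U⁰ be the (Laurent polynomial) subalgebra generated by all ω_i^{±1}, ω_i'^{±1}.
Then the multiplication map U_{r,s}(n⁻) ⊗ U⁰ ⊗ U_{r,s}(n) → U_{r,s}(g),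
x ⊗ h ⊗ y ↦ xhy, is an isomorphism of K-vector spaces (K = ℚ(r,s)).
-/

open scoped TensorProduct

set_option maxHeartbeats 1000000
set_option synthInstance.maxHeartbeats 1000000

noncomputable section

/-- K = ℚ(r,s) -/
abbrev KK : Type := FractionRing (MvPolynomial (Fin 2) ℚ)
def qr : KK := algebraMap (MvPolynomial (Fin 2) ℚ) KK (MvPolynomial.X 0)
def qs : KK := algebraMap (MvPolynomial (Fin 2) ℚ) KK (MvPolynomial.X 1)

variable (g : GT) (n : ℕ)

/-- U_{r,s}(n⁻), the subalgebra generated by the f_i -/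
def NmSub : Subalgebra KK (UG KK g n qr qs) :=
  Algebra.adjoin KK (Set.range fun i : Fin (rkOf g n) => genG qr qs (Gen.f i))

/-- U⁰, the subalgebra generated by the ω_i^{±1}, ω_i'^{±1} -/
def U0Sub : Subalgebra KK (UG KK g n qr qs) :=
  Algebra.adjoin KK
    ((Set.range fun i : Fin (rkOf g n) => genG qr qs (Gen.w i)) ∪
     (Set.range fun i : Fin (rkOf g n) => genG qr qs (Gen.winv i)) ∪
     (Set.range fun i : Fin (rkOf g n) => genG qr qs (Gen.wp i)) ∪
     (Set.range fun i : Fin (rkOf g n) => genG qr qs (Gen.wpinv i)))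

/-- U_{r,s}(n), the subalgebra generated by the e_i -/
def NpSub : Subalgebra KK (UG KK g n qr qs) :=
  Algebra.adjoin KK (Set.range fun i : Fin (rkOf g n) => genG qr qs (Gen.e i))

/-- the trilinear multiplication map (x, h, y) ↦ x * h * y -/
def mul3 : UG KK g n qr qs →ₗ[KK] UG KK g n qr qs →ₗ[KK]
    UG KK g n qr qs →ₗ[KK] UG KK g n qr qs :=
  (LinearMap.mul KK (UG KK g n qr qs)).compr₂ (LinearMap.mul KK (UG KK g n qr qs))

/-- its restriction to U_{r,s}(n⁻) × U⁰ × U_{r,s}(n) -/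
def triLin : ↥(NmSub g n) →ₗ[KK] ↥(U0Sub g n) →ₗ[KK]
    ↥(NpSub g n) →ₗ[KK] UG KK g n qr qs :=
  (((mul3 g n).comp (NmSub g n).val.toLinearMap).compl₂
      (U0Sub g n).val.toLinearMap).compr₂
    (LinearMap.lcomp KK _ (NpSub g n).val.toLinearMap)

/-- the multiplication map U_{r,s}(n⁻) ⊗ U⁰ ⊗ U_{r,s}(n) → U_{r,s}(g) -/
def triMap : (↥(NmSub g n) ⊗[KK] ↥(U0Sub g n)) ⊗[KK] ↥(NpSub g n) →ₗ[KK]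
    UG KK g n qr qs :=
  TensorProduct.lift (TensorProduct.lift (triLin g n))

namespace TriDec

section Serre

variable {A : Type*} [Ring A] [Algebra K A]

/-- The iterated twisted commutators `x ↦ e x - p q ^ m x e`, starting from `x`. -/
def serreSeq (p q : K) (e x : A) : ℕ → A
  | 0 => x
  | m + 1 => e * serreSeq p q e x m - (p * q ^ m) • (serreSeq p q e x m * e)

lemma map_serreSeq {B : Type*} [Ring B] [Algebra K B] (φ : A →ₐ[K] B) (p q : K) (e x : A)
    (m : ℕ) : φ (serreSeq p q e x m) = serreSeq p q (φ e) (φ x) m := by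
  induction m with
  | zero => rfl
  | succ m ih => simp [serreSeq, ih]

lemma serreSeq_mulLeft (p q : K) (e x : A) (m : ℕ) :
    serreSeq p q (LinearMap.mulLeft K e) (LinearMap.mulLeft K x) m
      = LinearMap.mulLeft K (serreSeq p q e x m) :=
  (map_serreSeq (Algebra.lmul K A) p q e x m).symm

lemma serreSeq_smul (p q a b : K) (e x : A) (m : ℕ) :
    serreSeq p q (a • e) (b • x) m = (a ^ m * b) • serreSeq p q e x m := by
  induction m with
  | zero => simp [serreSeq]
  | succ m ih =>
    simp only [serreSeq, ih, smul_mul_assoc, mul_smul_comm, smul_sub, smul_smul]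
    congr 2 <;> ring

lemma mul_serreSeq {p q a b : K} {e x w : A} (he : w * e = a • (e * w))
    (hx : w * x = b • (x * w)) (m : ℕ) :
    w * serreSeq p q e x m = (a ^ m * b) • (serreSeq p q e x m * w) := by
  induction m with
  | zero => simpa [serreSeq] using hx
  | succ m ih =>
    have h1 : w * (e * serreSeq p q e x m)
        = (a ^ (m + 1) * b) • (e * serreSeq p q e x m * w) := by
      rw [← mul_assoc, he, smul_mul_assoc, mul_assoc, ih, mul_smul_comm, smul_smul, mul_assoc]
      congr 1; ring
    have h2 : w * (serreSeq p q e x m * e)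
        = (a ^ (m + 1) * b) • (serreSeq p q e x m * e * w) := by
      rw [← mul_assoc, ih, smul_mul_assoc, mul_assoc, he, mul_smul_comm, smul_smul]
      congr 1
      · ring
      · simp only [mul_assoc]
    simp only [serreSeq, mul_sub, sub_mul, mul_smul_comm, smul_mul_assoc, h1, h2, smul_sub]
    rw [smul_comm]

lemma serreSeq_mul {p q a b : K} {e x w : A} (he : e * w = a • (w * e))
    (hx : x * w = b • (w * x)) (m : ℕ) :
    serreSeq p q e x m * w = (a ^ m * b) • (w * serreSeq p q e x m) := by
  induction m with
  | zero => simpa [serreSeq] using hx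
  | succ m ih =>
    have h1 : e * serreSeq p q e x m * w
        = (a ^ (m + 1) * b) • (w * (e * serreSeq p q e x m)) := by
      rw [mul_assoc, ih, mul_smul_comm, ← mul_assoc, he, smul_mul_assoc, smul_smul]
      congr 1
      · ring
      · simp only [mul_assoc]
    have h2 : serreSeq p q e x m * e * w
        = (a ^ (m + 1) * b) • (w * (serreSeq p q e x m * e)) := by
      rw [mul_assoc, he, mul_smul_comm, ← mul_assoc, ih, smul_mul_assoc, smul_smul]
      congr 1
      · ring
      · simp only [mul_assoc]
    simp only [serreSeq, mul_sub, sub_mul, mul_smul_comm, smul_mul_assoc, h1, h2, smul_sub]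
    rw [smul_comm]

lemma serre_derivation_left {p p' q : K} {e x t₁ t₂ : A} (h₁ : t₁ * e = q • (e * t₁))
    (h₁x : t₁ * x = p • (x * t₁)) (h₂ : e * t₂ = q • (t₂ * e)) (h₂x : x * t₂ = p' • (t₂ * x))
    {d : ℕ → A} (d0 : d 0 = 0)
    (hd : ∀ m, d (m + 1) = (t₁ - t₂) * serreSeq p q e x m + e * d m
      - (p * q ^ m) • (d m * e + serreSeq p q e x m * (t₁ - t₂))) (m : ℕ) :
    d (m + 1) = ((p * p' * q ^ m - 1) * ∑ l ∈ Finset.range (m + 1), q ^ l) •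
      (t₂ * serreSeq p q e x m) := by
  induction m with
  | zero =>
    have a := mul_serreSeq (p := p) (q := q) h₁ h₁x 0
    have b := serreSeq_mul (p := p) (q := q) h₂ h₂x 0
    rw [hd, d0, sub_mul, mul_sub, a, b]
    simp
    module
  | succ m ih =>
    have a := mul_serreSeq (p := p) (q := q) h₁ h₁x (m + 1)
    have b := serreSeq_mul (p := p) (q := q) h₂ h₂x (m + 1)
    rw [hd, sub_mul, mul_sub, a, b, ih]
    generalize hG : ∑ l ∈ Finset.range (m + 1), q ^ l = G
    have hG' : ∑ l ∈ Finset.range (m + 1 + 1), q ^ l = q * G + 1 := by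
      rw [Finset.sum_range_succ', ← hG, Finset.mul_sum]; simp [pow_succ']
    have hG'' : q * G + 1 = G + q ^ (m + 1) := by
      rw [← hG', Finset.sum_range_succ, hG]
    have h3 : e * (t₂ * serreSeq p q e x m) = q • (t₂ * (e * serreSeq p q e x m)) := by
      rw [← mul_assoc, h₂, smul_mul_assoc, mul_assoc]
    have h4 : t₂ * (e * serreSeq p q e x m) = t₂ * serreSeq p q e x (m + 1)
        + (p * q ^ m) • (t₂ * serreSeq p q e x m * e) := by
      simp only [serreSeq, mul_sub, mul_smul_comm, mul_assoc]; abel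
    have h5 : (p * p' * q ^ (m + 1) - 1) * (q * G + 1)
        = q * ((p * p' * q ^ m - 1) * G) + (p * q ^ (m + 1)) * (q ^ (m + 1) * p') - 1 := by
      rw [sub_mul, one_mul]
      nth_rewrite 1 [hG'']
      ring
    rw [hG', h5, mul_smul_comm, h3, h4]
    simp only [smul_mul_assoc, smul_add, smul_sub]
    module

lemma serre_derivation_right {p p' q : K} {e t₁ t₂ : A} (h₁ : t₁ * e = p' • (e * t₁))
    (h₂ : e * t₂ = p • (t₂ * e)) {d : ℕ → A} (d0 : d 0 = t₁ - t₂)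
    (hd : ∀ m, d (m + 1) = e * d m - (p * q ^ m) • (d m * e)) (m : ℕ) :
    d (m + 1) = (∏ l ∈ Finset.range (m + 1), (1 - p * p' * q ^ l)) • (e ^ (m + 1) * t₁) := by
  induction m with
  | zero =>
    rw [hd, d0, sub_mul, mul_sub, h₁, h₂]
    simp
    module
  | succ m ih =>
    rw [hd, ih, Finset.prod_range_succ _ (m + 1), mul_smul_comm, smul_mul_assoc, mul_assoc, h₁,
      ← mul_assoc, ← pow_succ', mul_smul_comm, ← mul_assoc, ← pow_succ]
    module

/-- A twisted derivation which is `δ_{lk} (t₁ - t₂)` on the generator `e l` annihilates the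
Serre elements. -/
lemma serre_derivation {I : Type*} [DecidableEq I] {Q : I → I → K} {e : I → A} {k : I}
    {t₁ t₂ : A} (h₁ : ∀ l, t₁ * e l = Q l k • (e l * t₁))
    (h₂ : ∀ l, e l * t₂ = Q k l • (t₂ * e l)) {i j : I} (hij : i ≠ j) {d : ℕ → A}
    (d0 : d 0 = if j = k then t₁ - t₂ else 0)
    (hd : ∀ m, d (m + 1) = (if i = k then t₁ - t₂ else 0) * serreSeq (Q j i) (Q i i) (e i) (e j) m
      + e i * d m - (Q j i * Q i i ^ m) • (d m * e i
        + serreSeq (Q j i) (Q i i) (e i) (e j) m * (if i = k then t₁ - t₂ else 0)))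
    {κ : ℕ} (hκ : Q i j * Q j i * Q i i ^ κ = 1) : d (κ + 1) = 0 := by
  by_cases hik : i = k
  · subst hik
    simp only [if_true, if_neg hij.symm] at d0 hd
    rw [serre_derivation_left (h₁ i) (h₁ j) (h₂ i) (h₂ j) d0 hd, mul_comm (Q j i), hκ]
    simp
  · simp only [if_neg hik, zero_mul, mul_zero, zero_add, add_zero] at hd
    by_cases hjk : j = k
    · subst hjk
      rw [if_pos rfl] at d0
      rw [serre_derivation_right (h₁ i) (h₂ i) d0 hd, Finset.prod_range_succ, mul_comm (Q j i), hκ]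
      simp
    · rw [if_neg hjk] at d0
      have : ∀ m, d m = 0 := fun m ↦ by
        induction m with
        | zero => exact d0
        | succ m ih => simp [hd, ih]
      exact this _

end Serre

section SerreAlg

variable {I : Type*} {q : I → I → K} {κ : I → I → ℕ}

inductive SerreRel (q : I → I → K) (κ : I → I → ℕ) : FreeAlgebra K I → FreeAlgebra K I → Prop
  | mk (i j : I) (h : i ≠ j) : SerreRel q κ
      (serreSeq (q j i) (q i i) (FreeAlgebra.ι K i) (FreeAlgebra.ι K j) (κ i j + 1)) 0

/-- The algebra with one generator for each index, subject to the Serre relations. -/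
def SerreAlg (q : I → I → K) (κ : I → I → ℕ) : Type _ := RingQuot (SerreRel q κ)

namespace SerreAlg

instance : Ring (SerreAlg q κ) := inferInstanceAs (Ring (RingQuot (SerreRel q κ)))

instance : Algebra K (SerreAlg q κ) := inferInstanceAs (Algebra K (RingQuot (SerreRel q κ)))

variable (q κ) in
/-- The quotient map from the free algebra. -/
def mk : FreeAlgebra K I →ₐ[K] SerreAlg q κ := RingQuot.mkAlgHom K (SerreRel q κ)

variable (q κ) in
def gen (i : I) : SerreAlg q κ := mk q κ (FreeAlgebra.ι K i)

lemma serre_gen {i j : I} (h : i ≠ j) :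
    serreSeq (q j i) (q i i) (gen q κ i) (gen q κ j) (κ i j + 1) = 0 := by
  have : mk q κ _ = mk q κ 0 := RingQuot.mkAlgHom_rel K (SerreRel.mk i j h)
  rwa [map_serreSeq, map_zero] at this

lemma adjoin_range_gen : Algebra.adjoin K (Set.range (gen q κ)) = ⊤ := by
  have h : Set.range (gen q κ)
      = mk q κ '' Set.range (FreeAlgebra.ι K) := by
    rw [← Set.range_comp]; rfl
  rw [h, ← AlgHom.map_adjoin, FreeAlgebra.adjoin_range_ι, Algebra.map_top,
    AlgHom.range_eq_top]
  exact RingQuot.mkAlgHom_surjective K _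

variable {A : Type*} [Ring A] [Algebra K A]

def lift (a : I → A)
    (h : ∀ i j, i ≠ j → serreSeq (q j i) (q i i) (a i) (a j) (κ i j + 1) = 0) :
    SerreAlg q κ →ₐ[K] A :=
  RingQuot.liftAlgHom K ⟨FreeAlgebra.lift K a, by
    rintro _ _ ⟨i, j, hij⟩
    simpa [map_serreSeq] using h i j hij⟩

@[simp] lemma lift_gen (a : I → A)
    (h : ∀ i j, i ≠ j → serreSeq (q j i) (q i i) (a i) (a j) (κ i j + 1) = 0) (i : I) :
    lift (q := q) (κ := κ) a h (gen q κ i) = a i :=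
  (RingQuot.liftAlgHom_mkAlgHom_apply K _ _ _).trans (FreeAlgebra.lift_ι_apply _ _)

end SerreAlg

lemma adjoin_le_of_mul_mem {A : Type*} [Ring A] [Algebra K A] {s : Set A}
    (S : Submodule K A) (h1 : 1 ∈ S) (h : ∀ a ∈ s, ∀ x ∈ S, a * x ∈ S) :
    Subalgebra.toSubmodule (Algebra.adjoin K s) ≤ S := by
  have key : ∀ a ∈ Algebra.adjoin K s, ∀ x ∈ S, a * x ∈ S := by
    intro a ha
    induction ha using Algebra.adjoin_induction with
    | mem a ha => exact h a ha
    | algebraMap r => intro x hx; rw [← Algebra.smul_def]; exact S.smul_mem _ hx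
    | add a b _ _ iha ihb => intro x hx; rw [add_mul]; exact S.add_mem (iha x hx) (ihb x hx)
    | mul a b _ _ iha ihb => intro x hx; rw [mul_assoc]; exact iha _ (ihb x hx)
  intro x hx
  simpa using key x hx 1 h1

lemma submodule_eq_top {A : Type*} [Ring A] [Algebra K A] {s : Set A}
    (hs : Algebra.adjoin K s = ⊤) (S : Submodule K A) (h1 : 1 ∈ S)
    (h : ∀ a ∈ s, ∀ x ∈ S, a * x ∈ S) : S = ⊤ :=
  top_le_iff.1 (by simpa [hs] using adjoin_le_of_mul_mem S h1 h)

namespace SerreAlg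

lemma submodule_eq_top (S : Submodule K (SerreAlg q κ)) (h1 : 1 ∈ S)
    (h : ∀ i, ∀ x ∈ S, gen q κ i * x ∈ S) : S = ⊤ :=
  TriDec.submodule_eq_top adjoin_range_gen S h1 (by rintro _ ⟨i, rfl⟩; exact h i)

lemma linearMap_ext {M : Type*} [AddCommGroup M] [Module K M] {f f' : SerreAlg q κ →ₗ[K] M}
    (h1 : f 1 = f' 1)
    (h : ∀ i x, f x = f' x → f (gen q κ i * x) = f' (gen q κ i * x)) : f = f' := by
  have := submodule_eq_top (LinearMap.eqLocus f f') h1 (fun i x hx ↦ h i x hx)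
  ext x
  have hx : x ∈ LinearMap.eqLocus f f' := this ▸ Submodule.mem_top
  exact hx

variable (q κ) in
/-- Left multiplication by a generator. -/
def mulGen (i : I) : Module.End K (SerreAlg q κ) := LinearMap.mulLeft K (gen q κ i)

lemma serre_mulGen {i j : I} (h : i ≠ j) :
    serreSeq (q j i) (q i i) (mulGen q κ i) (mulGen q κ j) (κ i j + 1) = 0 := by
  rw [mulGen, mulGen, serreSeq_mulLeft, serre_gen h, LinearMap.mulLeft_zero_eq_zero]

variable [DecidableEq I]

open TrivSqZeroExt in
theorem exists_twisted_derivation (hκ : ∀ i j, i ≠ j → q i j * q j i * q i i ^ κ i j = 1) (k : I)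
    {t₁ t₂ : Module.End K (SerreAlg q κ)}
    (h₁ : ∀ l, t₁ * mulGen q κ l = q l k • (mulGen q κ l * t₁))
    (h₂ : ∀ l, mulGen q κ l * t₂ = q k l • (t₂ * mulGen q κ l)) :
    ∃ D : Module.End K (SerreAlg q κ), D 1 = 0 ∧
      ∀ l, D * mulGen q κ l - mulGen q κ l * D = if l = k then t₁ - t₂ else 0 := by
  let E := Module.End K (SerreAlg q κ)
  let v : I → E := fun l ↦ if l = k then t₁ - t₂ else 0
  obtain ⟨a, ha1, ha2⟩ : ∃ a : I → TrivSqZeroExt E E,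
      (∀ l, (a l).fst = mulGen q κ l) ∧ ∀ l, (a l).snd = v l :=
    ⟨fun l ↦ (mulGen q κ l, v l), fun _ ↦ rfl, fun _ ↦ rfl⟩
  have hfst : ∀ i j m, (serreSeq (q j i) (q i i) (a i) (a j) m).fst
      = serreSeq (q j i) (q i i) (mulGen q κ i) (mulGen q κ j) m := by
    intro i j m
    induction m with
    | zero => exact ha1 j
    | succ m ih => simp only [serreSeq, fst_sub, fst_mul, fst_smul, ih, ha1]
  let ρ : SerreAlg q κ →ₐ[K] TrivSqZeroExt E E := lift a fun i j hij ↦ by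
    refine TrivSqZeroExt.ext ?_ ?_
    · rw [hfst, serre_mulGen hij]; rfl
    · refine serre_derivation (d := fun m ↦ (serreSeq (q j i) (q i i) (a i) (a j) m).snd)
        (k := k) h₁ h₂ hij ?_
        (fun m ↦ ?_) (hκ i j hij)
      · exact ha2 j
      simp only [serreSeq, snd_sub, snd_mul, snd_smul, hfst, ha1, ha2, smul_eq_mul,
        MulOpposite.smul_eq_mul_unop, MulOpposite.unop_op, v]
      rw [add_comm (serreSeq (q j i) (q i i) (mulGen q κ i) (mulGen q κ j) m * _),
        add_comm (mulGen q κ i * _)]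
  have hgen : ∀ l, ρ (gen q κ l) = a l := fun l ↦ lift_gen _ _ l
  have hρ : ∀ y, (ρ y).fst 1 = y := by
    have : (LinearMap.applyₗ (1 : SerreAlg q κ)) ∘ₗ (fstHom K E E).toLinearMap ∘ₗ ρ.toLinearMap
        = LinearMap.id := by
      refine linearMap_ext ?_ fun i x hx ↦ ?_
      · change (ρ 1).fst 1 = 1
        rw [map_one ρ]; rfl
      · change (ρ x).fst 1 = x at hx
        change (ρ (gen q κ i * x)).fst 1 = gen q κ i * x
        rw [map_mul, fst_mul, hgen, ha1, Module.End.mul_apply, hx]; rfl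
    exact LinearMap.congr_fun this
  let D : Module.End K (SerreAlg q κ) :=
    { toFun := fun y ↦ (ρ y).snd 1
      map_add' := fun x y ↦ by rw [map_add, snd_add, LinearMap.add_apply]
      map_smul' := fun c x ↦ by rw [map_smul, snd_smul, LinearMap.smul_apply, RingHom.id_apply] }
  refine ⟨D, ?_, fun l ↦ LinearMap.ext fun y ↦ ?_⟩
  · change (ρ 1).snd 1 = 0
    rw [map_one ρ]; rfl
  · change (ρ (gen q κ l * y)).snd 1 - mulGen q κ l ((ρ y).snd 1) = v l y
    rw [map_mul, snd_mul, hgen, ha1, ha2, smul_eq_mul, MulOpposite.smul_eq_mul_unop,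
      MulOpposite.unop_op, LinearMap.add_apply, Module.End.mul_apply, Module.End.mul_apply, hρ]
    abel

end SerreAlg

end SerreAlg

section Representation

variable {I : Type*}

/-- The toral generators. -/
inductive TGen (I : Type*)
  | w (i : I) | winv (i : I) | wp (i : I) | wpinv (i : I)

namespace TGen

def inv : TGen I → TGen I
  | w i => winv i
  | winv i => w i
  | wp i => wpinv i
  | wpinv i => wp i

@[simp] lemma inv_inv (x : TGen I) : x.inv.inv = x := by cases x <;> rfl

/-- The scalar `χ` with `x * e i = χ • (e i * x)`. -/
def wt (q : I → I → K) : TGen I → I → K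
  | w j, i => q i j
  | winv j, i => (q i j)⁻¹
  | wp j, i => (q j i)⁻¹
  | wpinv j, i => q j i

lemma wt_inv (q : I → I → K) (x : TGen I) (i : I) : x.inv.wt q i = (x.wt q i)⁻¹ := by
  cases x <;> simp [inv, wt]

lemma wt_ne_zero {q : I → I → K} (hq : ∀ i j, q i j ≠ 0) (x : TGen I) (i : I) :
    x.wt q i ≠ 0 := by
  cases x <;> simp [wt, hq]

end TGen

/-- The defining relations of the two-parameter quantum group with structure constants
`q i j = ⟨ω_i', ω_j⟩`, for a family of elements of an algebra. -/
structure IsRep [DecidableEq I] {A : Type*} [Ring A] [Algebra K A] (q : I → I → K) (c : I → K)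
    (κ : I → I → ℕ) (e f : I → A) (t : TGen I → A) : Prop where
  comm : ∀ x y, t x * t y = t y * t x
  mul_inv : ∀ x, t x * t x.inv = 1
  te : ∀ x i, t x * e i = x.wt q i • (e i * t x)
  tf : ∀ x i, t x * f i = (x.wt q i)⁻¹ • (f i * t x)
  ef : ∀ i j, e i * f j - f j * e i = if i = j then c i • (t (.w i) - t (.wp i)) else 0
  serre_e : ∀ i j, i ≠ j → serreSeq (q j i) (q i i) (e i) (e j) (κ i j + 1) = 0
  serre_f : ∀ i j, i ≠ j → serreSeq (q i j) (q i i) (f i) (f j) (κ i j + 1) = 0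

namespace SerreAlg

variable {q : I → I → K} {κ : I → I → ℕ}

variable (q κ) in
/-- The diagonal endomorphism rescaling the generators. -/
def scale (b : I → K) : SerreAlg q κ →ₐ[K] SerreAlg q κ :=
  lift (fun i ↦ b i • gen q κ i) fun i j hij ↦ by
    rw [serreSeq_smul, serre_gen hij, smul_zero]

lemma scale_gen (b : I → K) (i : I) : scale q κ b (gen q κ i) = b i • gen q κ i := lift_gen _ _ i

lemma scale_mul_mulGen (b : I → K) (i : I) :
    (scale q κ b).toLinearMap * mulGen q κ i
      = b i • (mulGen q κ i * (scale q κ b).toLinearMap) := by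
  refine LinearMap.ext fun y ↦ ?_
  change scale q κ b (gen q κ i * y) = b i • (gen q κ i * scale q κ b y)
  rw [map_mul, scale_gen, smul_mul_assoc]

lemma scale_scale (b b' : I → K) : (scale q κ b).toLinearMap * (scale q κ b').toLinearMap
    = (scale q κ (b * b')).toLinearMap := by
  refine linearMap_ext ?_ fun i x hx ↦ ?_
  · change scale q κ b (scale q κ b' 1) = scale q κ (b * b') 1
    simp only [map_one]
  · change scale q κ b (scale q κ b' x) = scale q κ (b * b') x at hx
    change scale q κ b (scale q κ b' (gen q κ i * x)) = scale q κ (b * b') (gen q κ i * x)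
    rw [map_mul, map_mul, hx, map_mul, scale_gen, scale_gen, map_smul, scale_gen, smul_smul,
      Pi.mul_apply, mul_comm (b' i)]

lemma scale_one : (scale q κ 1).toLinearMap = 1 := by
  refine linearMap_ext ?_ fun i x hx ↦ ?_
  · exact map_one (scale q κ 1)
  · change scale q κ 1 x = x at hx
    change scale q κ 1 (gen q κ i * x) = gen q κ i * x
    rw [map_mul, hx, scale_gen, Pi.one_apply, one_smul]

variable {R : Type*} [AddCommGroup R] [Module K R]

lemma end_tensor_eq_zero {X : Module.End K (SerreAlg q κ ⊗[K] R)}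
    (h : ∀ i, ∃ s : K, X * (mulGen q κ i).rTensor R = s • ((mulGen q κ i).rTensor R * X))
    (h1 : ∀ r : R, X ((1 : SerreAlg q κ) ⊗ₜ r) = 0) : X = 0 := by
  refine TensorProduct.ext' fun x r ↦ ?_
  refine LinearMap.congr_fun (f := X ∘ₗ (TensorProduct.mk K _ R).flip r) (g := 0)
    (linearMap_ext (h1 r) fun i x hx ↦ ?_) x
  obtain ⟨s, hs⟩ := h i
  have hx' : X (x ⊗ₜ r) = 0 := hx
  have := LinearMap.congr_fun hs (x ⊗ₜ r)
  change X ((gen q κ i * x) ⊗ₜ r) = s • (mulGen q κ i).rTensor R (X (x ⊗ₜ r)) at this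
  rw [hx', map_zero, smul_zero] at this
  exact this

end SerreAlg

/-- Relations holding on a generating subspace `ι R` extend to a highest-weight type module. -/
theorem IsRep.of_vacuum [DecidableEq I] {q : I → I → K} {κ : I → I → ℕ} {c : I → K}
    (hq : ∀ i j, q i j ≠ 0) (hκ : ∀ i j, i ≠ j → q i j * q j i * q i i ^ κ i j = 1)
    {R V : Type*} [AddCommGroup R] [Module K R] [AddCommGroup V] [Module K V] (ι : R → V)
    {Ω : TGen I → Module.End K R} {a : I → Module.End K R} {E F : I → Module.End K V}
    {T : TGen I → Module.End K V}
    (ha : ∀ x i, Ω x * a i = x.wt q i • (a i * Ω x))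
    (hserre : ∀ i j, i ≠ j → serreSeq (q j i) (q i i) (a i) (a j) (κ i j + 1) = 0)
    (hTcomm : ∀ x y, T x * T y = T y * T x) (hTinv : ∀ x, T x * T x.inv = 1)
    (hTF : ∀ x i, T x * F i = (x.wt q i)⁻¹ • (F i * T x))
    (hEF : ∀ i j, E i * F j - F j * E i = if i = j then c i • (T (.w i) - T (.wp i)) else 0)
    (hF : ∀ i j, i ≠ j → serreSeq (q i j) (q i i) (F i) (F j) (κ i j + 1) = 0)
    (hE1 : ∀ i r, E i (ι r) = ι (a i r)) (hT1 : ∀ x r, T x (ι r) = ι (Ω x r))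
    (hι : ∃ ι' : R →ₗ[K] V, ι = ι')
    (kill : ∀ X : Module.End K V, (∀ i, ∃ s : K, X * F i = s • (F i * X)) →
      (∀ r, X (ι r) = 0) → X = 0) : IsRep q c κ E F T := by
  obtain ⟨ι, rfl⟩ := hι
  have hTE : ∀ x i, T x * E i = x.wt q i • (E i * T x) := fun x i ↦ by
    refine sub_eq_zero.1 (kill _ (fun j ↦ ⟨(x.wt q j)⁻¹, ?_⟩) fun r ↦ ?_)
    · have h := sub_eq_iff_eq_add.1 (hEF i j)
      rw [sub_mul, smul_mul_assoc, mul_assoc, mul_assoc, h, hTF, mul_add, mul_smul_comm,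
        ← mul_assoc (E i), h, ← mul_assoc (T x), hTF]
      by_cases hij : i = j
      · subst hij
        have hne := x.wt_ne_zero hq i
        simp only [if_true, mul_sub, sub_mul, mul_smul_comm, smul_mul_assoc, add_mul, smul_add,
          smul_sub, mul_assoc, hTcomm x]
        match_scalars <;> field_simp <;> ring
      · simp only [if_neg hij, mul_zero, zero_add, smul_mul_assoc, mul_sub, mul_smul_comm,
          smul_sub, mul_assoc]
        rw [smul_comm]
    · change T x (E i (ι r)) - x.wt q i • E i (T x (ι r)) = 0
      have := LinearMap.congr_fun (ha x i) r
      change Ω x (a i r) = x.wt q i • a i (Ω x r) at this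
      rw [hE1, hT1, hT1, hE1, this, map_smul, sub_self]
  refine ⟨hTcomm, hTinv, hTE, hTF, hEF, fun i j hij ↦ ?_, hF⟩
  have hS1 : ∀ m r, serreSeq (q j i) (q i i) (E i) (E j) m (ι r)
      = ι (serreSeq (q j i) (q i i) (a i) (a j) m r) := fun m ↦ by
    induction m with
    | zero => exact hE1 j
    | succ m ih =>
      intro r
      simp only [serreSeq, LinearMap.sub_apply, LinearMap.smul_apply, Module.End.mul_apply, ih,
        hE1, map_sub, map_smul]
  refine kill _ (fun k ↦ ⟨1, ?_⟩) fun r ↦ by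
    rw [hS1, hserre i j hij, LinearMap.zero_apply, map_zero]
  rw [one_smul, ← sub_eq_zero]
  have hEF' : ∀ l, E l * F k - F k * E l
      = if l = k then c k • T (.w k) - c k • T (.wp k) else 0 := fun l ↦ by
    rw [hEF]
    by_cases h : l = k
    · subst h; simp [smul_sub]
    · simp [h]
  refine serre_derivation (Q := q) (e := E) (k := k) (t₁ := c k • T (.w k))
    (t₂ := c k • T (.wp k)) (i := i) (j := j)
    (d := fun m ↦ serreSeq (q j i) (q i i) (E i) (E j) m * F k
      - F k * serreSeq (q j i) (q i i) (E i) (E j) m)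
    (fun l ↦ ?_) (fun l ↦ ?_) hij (hEF' j) (fun m ↦ ?_) (hκ i j hij)
  · rw [smul_mul_assoc, hTE, mul_smul_comm, smul_comm]; rfl
  · rw [smul_mul_assoc, hTE, mul_smul_comm, smul_comm]
    simp only [TGen.wt, smul_inv_smul₀ (hq k l)]
  · rw [← hEF' i]
    simp only [serreSeq, sub_mul, mul_sub, smul_mul_assoc, mul_smul_comm, mul_assoc, smul_add,
      smul_sub]
    abel

open SerreAlg TensorProduct in
/-- A module over the Borel part extends to an induced module. -/
theorem exists_isRep_tensor [DecidableEq I] {q : I → I → K} {κ : I → I → ℕ} (c : I → K)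
    (hq : ∀ i j, q i j ≠ 0) (hκ : ∀ i j, i ≠ j → q i j * q j i * q i i ^ κ i j = 1)
    {R : Type*} [AddCommGroup R] [Module K R] {Ω : TGen I → Module.End K R}
    {a : I → Module.End K R} (hcomm : ∀ x y, Ω x * Ω y = Ω y * Ω x)
    (hinv : ∀ x, Ω x * Ω x.inv = 1) (ha : ∀ x i, Ω x * a i = x.wt q i • (a i * Ω x))
    (hserre : ∀ i j, i ≠ j → serreSeq (q j i) (q i i) (a i) (a j) (κ i j + 1) = 0) :
    ∃ (e : I → Module.End K (SerreAlg (fun i j ↦ q j i) κ ⊗[K] R))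
      (t : TGen I → Module.End K (SerreAlg (fun i j ↦ q j i) κ ⊗[K] R)),
      IsRep q c κ e (fun i ↦ (mulGen (fun i j ↦ q j i) κ i).rTensor R) t ∧
      (∀ i r, e i (1 ⊗ₜ r) = 1 ⊗ₜ a i r) ∧ ∀ x r, t x (1 ⊗ₜ r) = 1 ⊗ₜ Ω x r := by
  set q' : I → I → K := fun i j ↦ q j i with hq'
  have hκ' : ∀ i j, i ≠ j → q' i j * q' j i * q' i i ^ κ i j = 1 := fun i j hij ↦ by
    rw [← hκ i j hij, mul_comm (q' i j)]
  let σ : TGen I → Module.End K (SerreAlg q' κ) :=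
    fun x ↦ (scale q' κ fun i ↦ (x.wt q i)⁻¹).toLinearMap
  have hσ : ∀ x i, σ x * mulGen q' κ i = (x.wt q i)⁻¹ • (mulGen q' κ i * σ x) :=
    fun x i ↦ scale_mul_mulGen _ i
  have hσ1 : ∀ x, σ x 1 = 1 := fun x ↦ _root_.map_one (scale q' κ _)
  let T : TGen I → Module.End K (SerreAlg q' κ ⊗[K] R) := fun x ↦ map (σ x) (Ω x)
  have hT : ∀ x y, T x * T y = map (σ x * σ y) (Ω x * Ω y) :=
    fun x y ↦ (TensorProduct.map_mul _ _ _ _).symm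
  have hTinv : ∀ x, T x * T x.inv = 1 := fun x ↦ by
    rw [hT, hinv, scale_scale]
    have : (fun i ↦ (x.wt q i)⁻¹) * (fun i ↦ (x.inv.wt q i)⁻¹) = 1 := by
      funext i
      simp [x.wt_inv, x.wt_ne_zero hq]
    rw [this, scale_one, TensorProduct.map_one]
  have hTF : ∀ x i, T x * (mulGen q' κ i).rTensor R
      = (x.wt q i)⁻¹ • ((mulGen q' κ i).rTensor R * T x) := fun x i ↦ by
    change map (σ x) (Ω x) * map (mulGen q' κ i) 1
      = (x.wt q i)⁻¹ • (map (mulGen q' κ i) 1 * map (σ x) (Ω x))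
    rw [← TensorProduct.map_mul, ← TensorProduct.map_mul, hσ, map_smul_left, mul_one, one_mul]
  have hD₁ : ∀ k, ∃ D : Module.End K (SerreAlg q' κ), D 1 = 0 ∧ ∀ l x,
      D (gen q' κ l * x) = gen q' κ l * D x + if l = k then σ (.w k) x else 0 := fun k ↦ by
    obtain ⟨D, hD1, hD⟩ := exists_twisted_derivation hκ' k (t₁ := 0) (t₂ := σ (.w k)) (by simp)
      (fun l ↦ by rw [hσ, smul_smul]; simp [q', TGen.wt, hq])
    refine ⟨-D, by rw [LinearMap.neg_apply, hD1, neg_zero], fun l x ↦ ?_⟩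
    have := LinearMap.congr_fun (hD l) x
    change D (gen q' κ l * x) - gen q' κ l * D x = _ at this
    rw [LinearMap.neg_apply, LinearMap.neg_apply, sub_eq_iff_eq_add.1 this]
    split_ifs <;> simp
  have hD₂ : ∀ k, ∃ D : Module.End K (SerreAlg q' κ), D 1 = 0 ∧ ∀ l x,
      D (gen q' κ l * x) = gen q' κ l * D x + if l = k then σ (.wp k) x else 0 := fun k ↦ by
    obtain ⟨D, hD1, hD⟩ := exists_twisted_derivation hκ' k (t₁ := σ (.wp k)) (t₂ := 0)
      (fun l ↦ by rw [hσ]; simp [q', TGen.wt]) (by simp)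
    refine ⟨D, hD1, fun l x ↦ ?_⟩
    have := LinearMap.congr_fun (hD l) x
    change D (gen q' κ l * x) - gen q' κ l * D x = _ at this
    rw [sub_eq_iff_eq_add'.1 this]
    split_ifs <;> simp
  choose D₁ hD₁1 hD₁ using hD₁
  choose D₂ hD₂1 hD₂ using hD₂
  let E : I → Module.End K (SerreAlg q' κ ⊗[K] R) := fun i ↦
    map LinearMap.id (a i) + c i • (map (D₁ i) (Ω (.w i)) - map (D₂ i) (Ω (.wp i)))
  have hE : ∀ i x r, E i (x ⊗ₜ r)
      = x ⊗ₜ a i r + c i • (D₁ i x ⊗ₜ Ω (.w i) r - D₂ i x ⊗ₜ Ω (.wp i) r) := fun _ _ _ ↦ rfl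
  have hE1 : ∀ i r, E i (1 ⊗ₜ r) = 1 ⊗ₜ a i r := fun i r ↦ by
    rw [hE, hD₁1, hD₂1, zero_tmul, zero_tmul, sub_zero, smul_zero, add_zero]
  have hT1 : ∀ x r, T x (1 ⊗ₜ r) = 1 ⊗ₜ Ω x r := fun x r ↦ by
    change σ x 1 ⊗ₜ _ = _
    rw [hσ1]
  have hEF : ∀ i j, E i * (mulGen q' κ j).rTensor R - (mulGen q' κ j).rTensor R * E i
      = if i = j then c i • (T (.w i) - T (.wp i)) else 0 := fun i j ↦ by
    refine TensorProduct.ext' fun x r ↦ ?_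
    change E i ((gen q' κ j * x) ⊗ₜ r) - (mulGen q' κ j).rTensor R (E i (x ⊗ₜ r)) = _
    have h : ∀ y : SerreAlg q' κ, ∀ s : R,
      (mulGen q' κ j).rTensor R (y ⊗ₜ s) = (gen q' κ j * y) ⊗ₜ s := fun _ _ ↦ rfl
    rw [hE, hE, map_add, map_smul, map_sub, h, h, h, hD₁, hD₂]
    by_cases hij : j = i
    · subst hij
      simp only [if_true, add_tmul]
      change _ = c j • (σ (.w j) x ⊗ₜ[K] Ω (.w j) r - σ (.wp j) x ⊗ₜ[K] Ω (.wp j) r)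
      module
    · simp only [if_neg hij, if_neg (Ne.symm hij), add_zero, sub_self, LinearMap.zero_apply]
  refine ⟨E, T, IsRep.of_vacuum (R := R) (a := a) (V := SerreAlg q' κ ⊗[K] R) hq hκ (fun r : R ↦ (1 : SerreAlg q' κ) ⊗ₜ[K] r)
    ha hserre
    (fun x y ↦ ?_) hTinv hTF hEF (fun i j hij ↦ ?_) hE1 hT1
    ⟨TensorProduct.mk K (SerreAlg q' κ) R 1, rfl⟩
    fun (X : Module.End K (SerreAlg q' κ ⊗[K] R)) ↦ end_tensor_eq_zero, hE1, hT1⟩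
  · rw [hT, hT, hcomm, scale_scale, scale_scale, mul_comm]
  · have h := map_serreSeq (B := Module.End K (SerreAlg q' κ ⊗[K] R)) ((Module.End.rTensorAlgHom K (SerreAlg q' κ) R).comp
      (Algebra.lmul K (SerreAlg q' κ))) (q' j i) (q' i i) (gen q' κ i) (gen q' κ j) (κ i j + 1)
    rw [serre_gen hij, map_zero] at h
    exact h.symm

end Representation

section Torus

variable {I : Type*}

variable (K) in
inductive TorusRel (I : Type*) : FreeAlgebra K (TGen I) → FreeAlgebra K (TGen I) → Prop
  | comm (x y : TGen I) : TorusRel I (FreeAlgebra.ι K x * FreeAlgebra.ι K y)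
      (FreeAlgebra.ι K y * FreeAlgebra.ι K x)
  | mul_inv (x : TGen I) : TorusRel I (FreeAlgebra.ι K x * FreeAlgebra.ι K x.inv) 1

variable (K) in
/-- The Laurent polynomial algebra in the toral generators. -/
def Torus (I : Type*) : Type _ := RingQuot (TorusRel K I)

namespace Torus

instance : Ring (Torus K I) := inferInstanceAs (Ring (RingQuot (TorusRel K I)))

instance : Algebra K (Torus K I) := inferInstanceAs (Algebra K (RingQuot (TorusRel K I)))

variable (K I) in
/-- The quotient map from the free algebra. -/
def mk : FreeAlgebra K (TGen I) →ₐ[K] Torus K I := RingQuot.mkAlgHom K (TorusRel K I)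

variable (K) in
def gen (x : TGen I) : Torus K I := mk K I (FreeAlgebra.ι K x)

lemma gen_comm (x y : TGen I) : gen K x * gen K y = gen K y * gen K x := by
  have : mk K I _ = mk K I _ := RingQuot.mkAlgHom_rel K (TorusRel.comm x y)
  rwa [map_mul, map_mul] at this

lemma gen_mul_inv (x : TGen I) : gen K x * gen K x.inv = 1 := by
  have : mk K I _ = mk K I _ := RingQuot.mkAlgHom_rel K (TorusRel.mul_inv x)
  rwa [map_mul, map_one] at this

lemma adjoin_range_gen : Algebra.adjoin K (Set.range (gen K (I := I))) = ⊤ := by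
  have h : Set.range (gen K (I := I)) = mk K I '' Set.range (FreeAlgebra.ι K) := by
    rw [← Set.range_comp]; rfl
  rw [h, ← AlgHom.map_adjoin, FreeAlgebra.adjoin_range_ι, Algebra.map_top,
    AlgHom.range_eq_top]
  exact RingQuot.mkAlgHom_surjective K _

section lift

variable {A : Type*} [Ring A] [Algebra K A] (a : TGen I → A)
  (hcomm : ∀ x y, a x * a y = a y * a x) (hinv : ∀ x, a x * a x.inv = 1)

def lift : Torus K I →ₐ[K] A :=
  RingQuot.liftAlgHom K ⟨FreeAlgebra.lift K a, by
    rintro _ _ (⟨x, y⟩ | x)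
    · simpa using hcomm x y
    · simpa using hinv x⟩

@[simp] lemma lift_gen (x : TGen I) : lift a hcomm hinv (gen K x) = a x :=
  (RingQuot.liftAlgHom_mkAlgHom_apply K _ _ _).trans (FreeAlgebra.lift_ι_apply _ _)

end lift

lemma linearMap_ext {M : Type*} [AddCommGroup M] [Module K M] {f f' : Torus K I →ₗ[K] M}
    (h1 : f 1 = f' 1) (h : ∀ x z, f z = f' z → f (gen K x * z) = f' (gen K x * z)) : f = f' := by
  have := submodule_eq_top adjoin_range_gen (LinearMap.eqLocus f f') h1
    (by rintro _ ⟨x, rfl⟩ z hz; exact h x z hz)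
  ext z
  have hz : z ∈ LinearMap.eqLocus f f' := this ▸ Submodule.mem_top
  exact hz

variable {q : I → I → K} (hq : ∀ i j, q i j ≠ 0)

/-- The automorphism `z ↦ e i * z * (e i)⁻¹`. -/
def twist (i : I) : Torus K I →ₐ[K] Torus K I :=
  lift (fun x ↦ (x.wt q i)⁻¹ • gen K x)
    (fun x y ↦ by simp only [smul_mul_assoc, mul_smul_comm, gen_comm x y]; rw [smul_comm])
    (fun x ↦ by
      rw [smul_mul_assoc, mul_smul_comm, gen_mul_inv, smul_smul, x.wt_inv, inv_inv,
        inv_mul_cancel₀ (x.wt_ne_zero hq i), one_smul])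

lemma twist_gen (i : I) (x : TGen I) : twist hq i (gen K x) = (x.wt q i)⁻¹ • gen K x :=
  lift_gen _ _ _ x

lemma twist_comm (i j : I) : (twist hq i).toLinearMap * (twist hq j).toLinearMap
    = (twist hq j).toLinearMap * (twist hq i).toLinearMap := by
  refine linearMap_ext ?_ fun x z hz ↦ ?_
  · change twist hq i (twist hq j 1) = twist hq j (twist hq i 1)
    simp only [map_one]
  · change twist hq i (twist hq j z) = twist hq j (twist hq i z) at hz
    change twist hq i (twist hq j (gen K x * z)) = twist hq j (twist hq i (gen K x * z))
    rw [map_mul, map_mul, map_mul, map_mul, hz, twist_gen, twist_gen, map_smul, map_smul,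
      twist_gen, twist_gen, smul_comm]

end Torus

open TensorProduct in
lemma serreSeq_tensorMap {M N : Type*} [AddCommGroup M] [Module K M] [AddCommGroup N] [Module K N]
    {u v : Module.End K M} (huv : u * v = v * u) (p q : K) (e x : Module.End K N) (m : ℕ) (y : M)
    (z : N) : serreSeq (A := Module.End K (M ⊗[K] N)) p q (map u e) (map v x) m (y ⊗ₜ z)
      = (u ^ m * v) y ⊗ₜ serreSeq p q e x m z := by
  induction m generalizing y z with
  | zero => rfl
  | succ m ih =>
    change map u e (serreSeq (A := Module.End K (M ⊗[K] N)) p q (map u e) (map v x) m (y ⊗ₜ z))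
      - (p * q ^ m) • (serreSeq (A := Module.End K (M ⊗[K] N)) p q (map u e) (map v x) m
        (u y ⊗ₜ e z)) = _
    rw [ih, ih, map_tmul]
    have h1 : u ((u ^ m * v) y) = (u ^ (m + 1) * v) y := by rw [pow_succ', mul_assoc]; rfl
    have h2 : (u ^ m * v) (u y) = (u ^ (m + 1) * v) y := by
      rw [pow_succ, mul_assoc, huv, ← mul_assoc]; rfl
    rw [h1, h2, ← tmul_smul, ← tmul_sub]
    rfl

open SerreAlg TensorProduct in
theorem exists_isRep [DecidableEq I] {q : I → I → K} {κ : I → I → ℕ} (c : I → K)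
    (hq : ∀ i j, q i j ≠ 0) (hκ : ∀ i j, i ≠ j → q i j * q j i * q i i ^ κ i j = 1) :
    ∃ (e f : I → Module.End K (SerreAlg (fun i j ↦ q j i) κ ⊗[K] (Torus K I ⊗[K] SerreAlg q κ)))
      (t : TGen I → Module.End K
        (SerreAlg (fun i j ↦ q j i) κ ⊗[K] (Torus K I ⊗[K] SerreAlg q κ))),
      IsRep q c κ e f t ∧
      (∀ i x, e i (1 ⊗ₜ (1 ⊗ₜ x)) = 1 ⊗ₜ (1 ⊗ₜ (gen q κ i * x))) ∧
      (∀ x z y, t x (1 ⊗ₜ (z ⊗ₜ y)) = 1 ⊗ₜ ((Torus.gen K x * z) ⊗ₜ y)) ∧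
      ∀ i y r, f i (y ⊗ₜ r) = (gen (fun i j ↦ q j i) κ i * y) ⊗ₜ r := by
  let Ω : TGen I → Module.End K (Torus K I ⊗[K] SerreAlg q κ) :=
    fun x ↦ map (LinearMap.mulLeft K (Torus.gen K x)) LinearMap.id
  let a : I → Module.End K (Torus K I ⊗[K] SerreAlg q κ) :=
    fun i ↦ map (Torus.twist hq i).toLinearMap (mulGen q κ i)
  obtain ⟨e, t, h, he, ht⟩ := exists_isRep_tensor c hq hκ (Ω := Ω) (a := a)
    (fun x y ↦ TensorProduct.ext' fun z w ↦ by
      change (Torus.gen K x * (Torus.gen K y * z)) ⊗ₜ[K] w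
        = (Torus.gen K y * (Torus.gen K x * z)) ⊗ₜ[K] w
      rw [← mul_assoc, Torus.gen_comm, mul_assoc])
    (fun x ↦ TensorProduct.ext' fun z w ↦ by
      change (Torus.gen K x * (Torus.gen K x.inv * z)) ⊗ₜ[K] w = z ⊗ₜ w
      rw [← mul_assoc, Torus.gen_mul_inv, one_mul])
    (fun x i ↦ TensorProduct.ext' fun z w ↦ by
      change (Torus.gen K x * Torus.twist hq i z) ⊗ₜ[K] (gen q κ i * w)
        = x.wt q i • Torus.twist hq i (Torus.gen K x * z) ⊗ₜ[K] (gen q κ i * w)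
      rw [_root_.map_mul, Torus.twist_gen, smul_mul_assoc, smul_tmul',
        smul_inv_smul₀ (x.wt_ne_zero hq i)])
    (fun i j hij ↦ TensorProduct.ext' fun z w ↦ by
      rw [serreSeq_tensorMap (Torus.twist_comm hq i j), serre_mulGen hij, LinearMap.zero_apply,
        tmul_zero, LinearMap.zero_apply])
  refine ⟨e, _, t, h, fun i x ↦ ?_, fun x z y ↦ ht _ _, fun _ _ _ ↦ rfl⟩
  rw [he]
  change 1 ⊗ₜ (Torus.twist hq i 1 ⊗ₜ (gen q κ i * x)) = _
  rw [_root_.map_one]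

end Torus

section Presentation

variable {A : Type*} [Ring A] [Algebra K A]

lemma mul_inv_of_mul {a b x : A} {c : K} (hc : c ≠ 0) (hab : a * b = 1) (hba : b * a = 1)
    (h : a * x = c • (x * a)) : b * x = c⁻¹ • (x * b) := by
  have h' : b * (a * x) * b = c • (b * (x * a) * b) := by rw [h, mul_smul_comm, smul_mul_assoc]
  rw [← mul_assoc, hba, one_mul, mul_assoc b, mul_assoc x, hab, mul_one] at h'
  rw [h', smul_smul, inv_mul_cancel₀ hc, one_smul]

lemma mul_of_conj {a b x : A} {c : K} (hba : b * a = 1) (h : a * x * b = c • x) :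
    a * x = c • (x * a) := by
  rw [← smul_mul_assoc, ← h, mul_assoc _ b, hba, mul_one]

/-- The toral generators among all generators. -/
def TGen.toGen {N : ℕ} : TGen (Fin N) → Gen N
  | w i => .w i
  | winv i => .winv i
  | wp i => .wp i
  | wpinv i => .wpinv i

variable {g : GT} {n : ℕ}

lemma map_adE_iterate (φ : FG K g n →ₐ[K] A) {p q : K} {i j : Fin (rkOf g n)}
    (hinv : φ (FreeAlgebra.ι K (.w i)) * φ (FreeAlgebra.ι K (.winv i)) = 1)
    (hi : φ (FreeAlgebra.ι K (.w i)) * φ (FreeAlgebra.ι K (.e i))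
      = q • (φ (FreeAlgebra.ι K (.e i)) * φ (FreeAlgebra.ι K (.w i))))
    (hj : φ (FreeAlgebra.ι K (.w i)) * φ (FreeAlgebra.ι K (.e j))
      = p • (φ (FreeAlgebra.ι K (.e j)) * φ (FreeAlgebra.ι K (.w i)))) (m : ℕ) :
    φ ((adE i)^[m] (FreeAlgebra.ι K (.e j)))
      = serreSeq p q (φ (FreeAlgebra.ι K (.e i))) (φ (FreeAlgebra.ι K (.e j))) m := by
  induction m with
  | zero => rfl
  | succ m ih =>
    rw [Function.iterate_succ_apply', adE, map_sub, map_mul, map_mul, map_mul, map_mul, ih,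
      mul_serreSeq hi hj, smul_mul_assoc, mul_assoc _ _ (φ (FreeAlgebra.ι K (.winv i))), hinv,
      mul_one, smul_mul_assoc, mul_comm (q ^ m)]
    rfl

lemma map_adF_iterate (φ : FG K g n →ₐ[K] A) {p q : K} (hp : p ≠ 0) (hq : q ≠ 0)
    {i j : Fin (rkOf g n)}
    (hinv : φ (FreeAlgebra.ι K (.wpinv i)) * φ (FreeAlgebra.ι K (.wp i)) = 1)
    (hi : φ (FreeAlgebra.ι K (.wpinv i)) * φ (FreeAlgebra.ι K (.f i))
      = q⁻¹ • (φ (FreeAlgebra.ι K (.f i)) * φ (FreeAlgebra.ι K (.wpinv i))))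
    (hj : φ (FreeAlgebra.ι K (.wpinv i)) * φ (FreeAlgebra.ι K (.f j))
      = p⁻¹ • (φ (FreeAlgebra.ι K (.f j)) * φ (FreeAlgebra.ι K (.wpinv i)))) (m : ℕ) :
    ∃ s : K, s ≠ 0 ∧ φ ((adF i)^[m] (FreeAlgebra.ι K (.f j)))
      = s • serreSeq p q (φ (FreeAlgebra.ι K (.f i))) (φ (FreeAlgebra.ι K (.f j))) m := by
  induction m with
  | zero => exact ⟨1, one_ne_zero, (one_smul _ _).symm⟩
  | succ m ih =>
    obtain ⟨s, hs, ih⟩ := ih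
    have hu : p * q ^ m ≠ 0 := mul_ne_zero hp (pow_ne_zero m hq)
    refine ⟨-((p * q ^ m)⁻¹ * s), neg_ne_zero.2 (mul_ne_zero (inv_ne_zero hu) hs), ?_⟩
    rw [Function.iterate_succ_apply', adF, map_sub, map_mul, map_mul, map_mul, map_mul, ih]
    simp only [mul_smul_comm, smul_mul_assoc, serreSeq]
    rw [mul_assoc (φ (FreeAlgebra.ι K (.f i))) (φ (FreeAlgebra.ι K (.wpinv i))),
      mul_serreSeq hi hj]
    simp only [mul_smul_comm, smul_mul_assoc, mul_assoc, hinv, mul_one, inv_pow]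
    match_scalars <;> field_simp

/-- The exponents `-a i j` of the Serre relations. -/
def serreExp (g : GT) (n : ℕ) (i j : Fin (rkOf g n)) : ℕ := (1 - aG g (rkOf g n) i j).toNat - 1

variable (ρ σ : K)

lemma genG_isRep
    (hq : ∀ i j : Fin (rkOf g n), cstG g (rkOf g n) ρ σ i j ≠ 0)
    (ha : ∀ i j : Fin (rkOf g n), i ≠ j → 1 ≤ (1 - aG g (rkOf g n) i j).toNat) :
    IsRep (fun i j : Fin (rkOf g n) ↦ cstG g (rkOf g n) ρ σ i j)
      (fun i ↦ (riG g (rkOf g n) ρ i - riG g (rkOf g n) σ i)⁻¹)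
      (serreExp g n) (fun i ↦ genG ρ σ (.e i)) (fun i ↦ genG (g := g) (n := n) ρ σ (.f i))
      (fun x ↦ genG ρ σ x.toGen) := by
  set φ := RingQuot.mkAlgHom K (RelG g n ρ σ) with hφ
  have rel : ∀ {x y}, RelG g n ρ σ x y → φ x = φ y := fun h ↦ RingQuot.mkAlgHom_rel K h
  have rel_one : ∀ {x y : Gen (rkOf g n)},
      RelG g n ρ σ (FreeAlgebra.ι K x * FreeAlgebra.ι K y) 1 →
      genG (g := g) (n := n) ρ σ x * genG ρ σ y = 1 := fun h ↦ by
    have := rel h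
    rwa [map_mul, map_one] at this
  have rel_conj : ∀ {x y z : Gen (rkOf g n)} {c : K},
      RelG g n ρ σ (FreeAlgebra.ι K x * FreeAlgebra.ι K y * FreeAlgebra.ι K z)
        (c • FreeAlgebra.ι K y) →
      genG (g := g) (n := n) ρ σ x * genG ρ σ y * genG ρ σ z = c • genG ρ σ y := fun h ↦ by
    have := rel h
    rwa [map_mul, map_mul, map_smul] at this
  have hinv : ∀ x : TGen (Fin (rkOf g n)),
      genG (g := g) (n := n) ρ σ x.toGen * genG ρ σ x.inv.toGen = 1 := fun x ↦ by
    cases x with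
    | w i => exact rel_one (.winv_r i)
    | winv i => exact rel_one (.winv_l i)
    | wp i => exact rel_one (.wpinv_r i)
    | wpinv i => exact rel_one (.wpinv_l i)
  have hinv' : ∀ x : TGen (Fin (rkOf g n)),
      genG (g := g) (n := n) ρ σ x.inv.toGen * genG ρ σ x.toGen = 1 := fun x ↦ by
    simpa using hinv x.inv
  have key : ∀ (X : TGen (Fin (rkOf g n))) (v : UG K g n ρ σ) (c : K), c ≠ 0 →
      genG ρ σ X.toGen * v = c • (v * genG ρ σ X.toGen) →
      genG ρ σ X.inv.toGen * v = c⁻¹ • (v * genG ρ σ X.inv.toGen) := fun X v c hc h ↦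
    mul_inv_of_mul hc (hinv X) (hinv' X) h
  have hwE : ∀ i j, genG (g := g) (n := n) ρ σ (.w j) * genG ρ σ (.e i)
      = cstG g (rkOf g n) ρ σ i j • (genG ρ σ (.e i) * genG ρ σ (.w j)) := fun i j ↦
    mul_of_conj (hinv' (.w j)) (rel_conj (.wE i j))
  have hwF : ∀ i j, genG (g := g) (n := n) ρ σ (.w j) * genG ρ σ (.f i)
      = (cstG g (rkOf g n) ρ σ i j)⁻¹ • (genG ρ σ (.f i) * genG ρ σ (.w j)) := fun i j ↦
    mul_of_conj (hinv' (.w j)) (rel_conj (.wF i j))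
  have hwpE : ∀ i j, genG (g := g) (n := n) ρ σ (.wp j) * genG ρ σ (.e i)
      = (cstG g (rkOf g n) ρ σ j i)⁻¹ • (genG ρ σ (.e i) * genG ρ σ (.wp j)) := fun i j ↦
    mul_of_conj (hinv' (.wp j)) (rel_conj (.wpE i j))
  have hwpF : ∀ i j, genG (g := g) (n := n) ρ σ (.wp j) * genG ρ σ (.f i)
      = cstG g (rkOf g n) ρ σ j i • (genG ρ σ (.f i) * genG ρ σ (.wp j)) := fun i j ↦
    mul_of_conj (hinv' (.wp j)) (rel_conj (.wpF i j))
  refine ⟨fun x y ↦ ?_, hinv, fun x i ↦ ?_, fun x i ↦ ?_, fun i j ↦ ?_, fun i j hij ↦ ?_,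
    fun i j hij ↦ ?_⟩
  · have hx : ∀ x : TGen (Fin (rkOf g n)), x.toGen.toral := fun x ↦ by cases x <;> trivial
    have := rel (.comm _ _ (hx x) (hx y))
    rwa [map_mul, map_mul] at this
  · cases x with
    | w j => exact hwE i j
    | winv j => exact key (.w j) _ _ (hq i j) (hwE i j)
    | wp j => exact hwpE i j
    | wpinv j =>
      have := key (.wp j) _ _ (inv_ne_zero (hq j i)) (hwpE i j)
      rwa [inv_inv] at this
  · cases x with
    | w j => exact hwF i j
    | winv j => exact key (.w j) _ _ (inv_ne_zero (hq i j)) (hwF i j)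
    | wp j =>
      change _ = (cstG g (rkOf g n) ρ σ j i)⁻¹⁻¹ • _
      rw [inv_inv]; exact hwpF i j
    | wpinv j => exact key (.wp j) _ _ (hq j i) (hwpF i j)
  · have := rel (.ef i j)
    rw [map_sub, map_mul, map_mul, apply_ite φ, map_smul, map_sub, map_zero] at this
    exact this
  · have := rel (.serreE i j hij)
    rw [map_zero, map_adE_iterate φ (hinv (.w i)) (hwE i i) (hwE j i),
      ← Nat.sub_add_cancel (ha i j hij)] at this
    exact this
  · obtain ⟨s, hs, h⟩ := map_adF_iterate φ (hq i j) (hq i i) (hinv (.wpinv i))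
      (key (.wp i) _ _ (hq i i) (hwpF i i)) (key (.wp i) _ _ (hq i j) (hwpF j i))
      (1 - aG g (rkOf g n) i j).toNat
    rw [rel (.serreF i j hij), map_zero, ← Nat.sub_add_cancel (ha i j hij)] at h
    exact (smul_eq_zero.1 h.symm).resolve_left hs

/-- Extension of families indexed by the three kinds of generators. -/
def Gen.elim' {α : Type*} {N : ℕ} (e f : Fin N → α) (t : TGen (Fin N) → α) : Gen N → α
  | .e i => e i
  | .f i => f i
  | .w i => t (.w i)
  | .winv i => t (.winv i)
  | .wp i => t (.wp i)
  | .wpinv i => t (.wpinv i)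

lemma Gen.elim'_toGen {α : Type*} {N : ℕ} (e f : Fin N → α) (t : TGen (Fin N) → α)
    (x : TGen (Fin N)) : Gen.elim' e f t x.toGen = t x := by cases x <;> rfl

lemma exists_toGen {N : ℕ} {x : Gen N} (hx : x.toral) : ∃ y : TGen (Fin N), y.toGen = x := by
  cases x with
  | e i => exact hx.elim
  | f i => exact hx.elim
  | w i => exact ⟨.w i, rfl⟩
  | winv i => exact ⟨.winv i, rfl⟩
  | wp i => exact ⟨.wp i, rfl⟩
  | wpinv i => exact ⟨.wpinv i, rfl⟩

lemma IsRep.exists_algHom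
    (hq : ∀ i j : Fin (rkOf g n), cstG g (rkOf g n) ρ σ i j ≠ 0)
    (ha : ∀ i j : Fin (rkOf g n), i ≠ j → 1 ≤ (1 - aG g (rkOf g n) i j).toNat)
    {e f : Fin (rkOf g n) → A} {t : TGen (Fin (rkOf g n)) → A}
    (h : IsRep (fun i j : Fin (rkOf g n) ↦ cstG g (rkOf g n) ρ σ i j)
      (fun i ↦ (riG g (rkOf g n) ρ i - riG g (rkOf g n) σ i)⁻¹) (serreExp g n) e f t) :
    ∃ Ψ : UG K g n ρ σ →ₐ[K] A, (∀ i, Ψ (genG ρ σ (.e i)) = e i) ∧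
      (∀ i, Ψ (genG ρ σ (.f i)) = f i) ∧ ∀ x, Ψ (genG ρ σ (TGen.toGen x)) = t x := by
  let φ : FG K g n →ₐ[K] A := FreeAlgebra.lift K (Gen.elim' e f t)
  have hφ : ∀ x, φ (FreeAlgebra.ι K x) = Gen.elim' e f t x := FreeAlgebra.lift_ι_apply _
  have conj : ∀ (x : TGen (Fin (rkOf g n))) (v : A) (c : K), t x * v = c • (v * t x) →
      t x * v * t x.inv = c • v := fun x v c hc ↦ by
    rw [hc, smul_mul_assoc, mul_assoc, h.mul_inv, mul_one]
  have rel : ∀ ⦃x y⦄, RelG g n ρ σ x y → φ x = φ y := by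
    intro x y hxy
    cases hxy with
    | comm x y hx hy =>
      obtain ⟨x, rfl⟩ := exists_toGen hx
      obtain ⟨y, rfl⟩ := exists_toGen hy
      rw [map_mul, map_mul, hφ, hφ, Gen.elim'_toGen, Gen.elim'_toGen, h.comm]
    | winv_r i => rw [map_mul, map_one, hφ, hφ]; exact h.mul_inv (.w i)
    | winv_l i => rw [map_mul, map_one, hφ, hφ]; exact h.mul_inv (.winv i)
    | wpinv_r i => rw [map_mul, map_one, hφ, hφ]; exact h.mul_inv (.wp i)
    | wpinv_l i => rw [map_mul, map_one, hφ, hφ]; exact h.mul_inv (.wpinv i)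
    | wE i j =>
      rw [map_mul, map_mul, map_smul, hφ, hφ, hφ]
      exact conj (.w j) _ _ (h.te (.w j) i)
    | wF i j =>
      rw [map_mul, map_mul, map_smul, hφ, hφ, hφ]
      exact conj (.w j) _ _ (h.tf (.w j) i)
    | wpE i j =>
      rw [map_mul, map_mul, map_smul, hφ, hφ, hφ]
      exact conj (.wp j) _ _ (h.te (.wp j) i)
    | wpF i j =>
      rw [map_mul, map_mul, map_smul, hφ, hφ, hφ, ← inv_inv (cstG g (rkOf g n) ρ σ j i)]
      exact conj (.wp j) _ _ (h.tf (.wp j) i)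
    | ef i j =>
      rw [map_sub, map_mul, map_mul, apply_ite φ, map_smul, map_sub, map_zero, hφ, hφ, hφ, hφ]
      exact h.ef i j
    | serreE i j hij =>
      rw [map_zero, map_adE_iterate φ (p := cstG g (rkOf g n) ρ σ j i)
        (q := cstG g (rkOf g n) ρ σ i i), ← Nat.sub_add_cancel (ha i j hij), hφ, hφ]
      · exact h.serre_e i j hij
      · rw [hφ, hφ]; exact h.mul_inv (.w i)
      · rw [hφ, hφ]; exact h.te (.w i) i
      · rw [hφ, hφ]; exact h.te (.w i) j
    | serreF i j hij =>
      obtain ⟨s, -, hs⟩ := map_adF_iterate φ (hq i j) (hq i i) (i := i) (j := j)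
        (by rw [hφ, hφ]; exact h.mul_inv (.wpinv i)) (by rw [hφ, hφ]; exact h.tf (.wpinv i) i)
        (by rw [hφ, hφ]; exact h.tf (.wpinv i) j) (1 - aG g (rkOf g n) i j).toNat
      rw [map_zero, hs, ← Nat.sub_add_cancel (ha i j hij), hφ, hφ]
      exact (congrArg (s • ·) (h.serre_f i j hij)).trans (smul_zero s)
  refine ⟨RingQuot.liftAlgHom K ⟨φ, rel⟩, fun i ↦ ?_, fun i ↦ ?_, fun x ↦ ?_⟩
  · exact (RingQuot.liftAlgHom_mkAlgHom_apply K _ _ _).trans (hφ _)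
  · exact (RingQuot.liftAlgHom_mkAlgHom_apply K _ _ _).trans (hφ _)
  · exact (RingQuot.liftAlgHom_mkAlgHom_apply K _ _ _).trans ((hφ _).trans (Gen.elim'_toGen _ _ _ _))

end Presentation

section StructureConstants

lemma ipaG_of_short {g : GT} {N i : ℕ} (h : g = .A ∨ i + 1 < N) (k : ℕ) :
    ipaG g N k i = (if k = i then 1 else 0) - (if k = i + 1 then 1 else 0) :=
  if_pos h

lemma apaG_of_short {g : GT} {N i : ℕ} (hi : i < N) (h : g = .A ∨ i + 1 < N) (j : ℕ) :
    apaG g N i j = ipaG g N i j - ipaG g N (i + 1) j := by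
  simp only [apaG, ipaG_of_short h, sub_mul, Finset.sum_sub_distrib, ite_mul, one_mul, zero_mul,
    Finset.sum_ite_eq', Finset.mem_range]
  rw [if_pos (by omega), if_pos (by omega)]

lemma ipaG_B_last (n k : ℕ) : ipaG .B (n + 1) k n = if k = n then 1 else 0 := by
  simp [ipaG]

lemma ipaG_C_last (n k : ℕ) : ipaG .C (n + 1) k n = if k = n then 2 else 0 := by
  simp [ipaG]

lemma ipaG_D_last (n k : ℕ) : ipaG .D (n + 2) k (n + 1)
    = (if k = n then 1 else 0) + (if k = n + 1 then 1 else 0) := by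
  simp only [ipaG]
  split_ifs <;> simp_all

lemma apaG_B_last (n j : ℕ) : apaG .B (n + 1) n j = ipaG .B (n + 1) n j := by
  simp [apaG, ipaG_B_last, Finset.sum_ite_eq']

lemma apaG_C_last (n j : ℕ) : apaG .C (n + 1) n j = 2 * ipaG .C (n + 1) n j := by
  simp [apaG, ipaG_C_last, Finset.sum_ite_eq']

lemma apaG_D_last (n j : ℕ) :
    apaG .D (n + 2) (n + 1) j = ipaG .D (n + 2) n j + ipaG .D (n + 2) (n + 1) j := by
  simp [apaG, ipaG_D_last, Finset.sum_ite_eq', add_mul, Finset.sum_add_distrib]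

lemma cstG_ne_zero {ρ σ : K} (hρ : ρ ≠ 0) (hσ : σ ≠ 0) (g : GT) (N i j : ℕ) :
    cstG g N ρ σ i j ≠ 0 := by
  have h : ∀ a b : ℤ, ρ ^ a * σ ^ b ≠ 0 := fun a b ↦
    mul_ne_zero (zpow_ne_zero a hρ) (zpow_ne_zero b hσ)
  cases g with
  | A => exact h _ _
  | B =>
    simp only [cstG]
    split_ifs
    exacts [h _ _, zpow_ne_zero _ hρ, mul_ne_zero hρ (inv_ne_zero hσ)]
  | C =>
    simp only [cstG]
    split_ifs
    exacts [h _ _, zpow_ne_zero _ hρ, mul_ne_zero (pow_ne_zero 2 hρ) (zpow_ne_zero _ hσ)]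
  | D =>
    simp only [cstG]
    split_ifs
    exacts [h _ _, h _ _, h _ _]

/-- The identity `q i j * q j i = q i i ^ a i j` for nonpositive `a i j`. -/
def CartanRel (g : GT) (N : ℕ) (ρ σ : K) (i j : ℕ) : Prop :=
  ∃ k : ℕ, aG g N i j = -k ∧ cstG g N ρ σ i j * cstG g N ρ σ j i * cstG g N ρ σ i i ^ k = 1

lemma short_identity {ρ σ : K} (hρ : ρ ≠ 0) (hσ : σ ≠ 0) {i j k : ℕ}
    (hij : i ≠ j) (hk : k = if j = i + 1 ∨ i = j + 1 then 1 else 0) :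
    (ρ ^ (((if j = i then 1 else 0) - (if j = i + 1 then 1 else 0) : ℤ)) *
        σ ^ (((if j + 1 = i then 1 else 0) - (if j + 1 = i + 1 then 1 else 0) : ℤ))) *
      (ρ ^ (((if i = j then 1 else 0) - (if i = j + 1 then 1 else 0) : ℤ)) *
        σ ^ (((if i + 1 = j then 1 else 0) - (if i + 1 = j + 1 then 1 else 0) : ℤ))) *
      (ρ ^ (((if i = i then 1 else 0) - (if i = i + 1 then 1 else 0) : ℤ)) *
        σ ^ (((if i + 1 = i then 1 else 0) - (if i + 1 = i + 1 then 1 else 0) : ℤ))) ^ k = 1 := by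
  rcases eq_or_ne j (i + 1) with rfl | hj
  · have h1 : ¬ i = i + 1 + 1 := by omega
    have h2 : ¬ i + 1 + 1 = i := by omega
    simp [hk, h1, h2]
    field_simp
  rcases eq_or_ne i (j + 1) with rfl | hi
  · have h1 : ¬ j = j + 1 + 1 := by omega
    have h2 : ¬ j + 1 + 1 = j := by omega
    simp [hk, h1, h2]
    field_simp
  · simp [hk, hij, hij.symm, hi, hj, hi.symm, hj.symm]

lemma aG_of_short {g : GT} {N i j : ℕ} (hi : i < N) (hij : i ≠ j) (h : g = .A ∨ i + 1 < N)
    (h' : g = .A ∨ j + 1 < N) :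
    aG g N i j = -((if j = i + 1 ∨ i = j + 1 then 1 else 0 : ℕ) : ℤ) := by
  have h1 : apaG g N i i = 2 := by simp [apaG_of_short hi h, ipaG_of_short h]
  have h2 := apaG_of_short hi h j
  simp only [ipaG_of_short h'] at h2
  simp only [aG, h1, h2]
  rcases eq_or_ne j (i + 1) with rfl | hj
  · have h1 : ¬ i = i + 1 + 1 := by omega
    simp [h1]
  rcases eq_or_ne i (j + 1) with rfl | hi
  · have h1 : ¬ j + 1 + 1 = j := by omega
    simp [h1]
  · simp [hij, hi, hj, hj.symm]

lemma cartanRel_of_short {ρ σ : K} (hρ : ρ ≠ 0) (hσ : σ ≠ 0) {g : GT} {N i j : ℕ}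
    (hi : i < N) (hij : i ≠ j) (h : g = .A ∨ i + 1 < N) (h' : g = .A ∨ j + 1 < N) :
    CartanRel g N ρ σ i j := by
  refine ⟨_, aG_of_short hi hij h h', ?_⟩
  cases g with
  | A =>
    refine .trans ?_ (short_identity hρ hσ hij rfl)
    simp only [cstG, ipaG_of_short h, ipaG_of_short h']
  | B =>
    have h₁ : i + 1 < N := by simpa using h
    have h₂ : j + 1 < N := by simpa using h'
    refine .trans ?_ (short_identity (zpow_ne_zero 2 hρ) (zpow_ne_zero 2 hσ) hij rfl)
    simp only [cstG, ipaG_of_short h, ipaG_of_short h', if_pos h₁, if_pos h₂, zpow_mul]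
  | C =>
    have h₁ : i + 1 < N := by simpa using h
    have h₂ : j + 1 < N := by simpa using h'
    refine .trans ?_ (short_identity hρ hσ hij rfl)
    simp only [cstG, ipaG_of_short h, ipaG_of_short h', if_pos h₁, if_pos h₂]
  | D =>
    have h₁ : i + 1 < N := by simpa using h
    have h₂ : j + 1 < N := by simpa using h'
    refine .trans ?_ (short_identity hρ hσ hij rfl)
    simp only [cstG, ipaG_of_short h, ipaG_of_short h', if_pos h₁, if_pos h₂]

lemma cartanRel_B_last {ρ σ : K} (hρ : ρ ≠ 0) (hσ : σ ≠ 0) {n j : ℕ}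
    (hj : j < n) :
    CartanRel .B (n + 1) ρ σ n j ∧ CartanRel .B (n + 1) ρ σ j n := by
  have hs : ∀ k, ipaG .B (n + 1) k j = _ := ipaG_of_short (Or.inr (by omega))
  have hjj : apaG .B (n + 1) j j = 2 := by
    simp [apaG_of_short (show j < n + 1 by omega) (Or.inr (show j + 1 < n + 1 by omega)), hs]
  have hjn := apaG_of_short (g := .B) (show j < n + 1 by omega) (Or.inr (show j + 1 < n + 1 by omega)) n
  simp only [CartanRel, aG, cstG, apaG_B_last, hjj, hjn, ipaG_B_last, hs, lt_irrefl, if_false,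
    if_pos (show j + 1 < n + 1 by omega), Nat.add_sub_cancel]
  obtain rfl | hn := eq_or_ne n (j + 1)
  · have h1 : ¬ j + 1 + 1 = j := by omega
    constructor
    · refine ⟨2, ?_, ?_⟩ <;> simp
      field_simp
    · refine ⟨1, ?_, ?_⟩ <;> simp
      field_simp
  · have h1 : n ≠ j := by omega
    constructor <;> refine ⟨0, ?_, ?_⟩ <;> simp [h1, h1.symm, hn, hn.symm]

lemma cartanRel_C_last {ρ σ : K} (hρ : ρ ≠ 0) (hσ : σ ≠ 0) {n j : ℕ}
    (hj : j < n) :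
    CartanRel .C (n + 1) ρ σ n j ∧ CartanRel .C (n + 1) ρ σ j n := by
  have hs : ∀ k, ipaG .C (n + 1) k j = _ := ipaG_of_short (Or.inr (by omega))
  have hjj : apaG .C (n + 1) j j = 2 := by
    simp [apaG_of_short (show j < n + 1 by omega) (Or.inr (show j + 1 < n + 1 by omega)), hs]
  have hjn := apaG_of_short (g := .C) (show j < n + 1 by omega) (Or.inr (show j + 1 < n + 1 by omega)) n
  simp only [CartanRel, aG, cstG, apaG_C_last, hjj, hjn, ipaG_C_last, hs, lt_irrefl, if_false,
    if_pos (show j + 1 < n + 1 by omega), Nat.add_sub_cancel]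
  obtain rfl | hn := eq_or_ne n (j + 1)
  · have h1 : ¬ j + 1 + 1 = j := by omega
    constructor
    · refine ⟨1, ?_, ?_⟩ <;> simp
      field_simp
    · refine ⟨2, ?_, ?_⟩ <;> simp
      field_simp
  · have h1 : n ≠ j := by omega
    constructor <;> refine ⟨0, ?_, ?_⟩ <;> simp [h1, h1.symm, hn, hn.symm]

lemma cartanRel_D_last {ρ σ : K} (hρ : ρ ≠ 0) (hσ : σ ≠ 0) {n j : ℕ}
    (hj : j < n + 1) :
    CartanRel .D (n + 2) ρ σ (n + 1) j ∧ CartanRel .D (n + 2) ρ σ j (n + 1) := by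
  have hs : ∀ k, ipaG .D (n + 2) k j = _ := ipaG_of_short (Or.inr (by omega))
  have hjj : apaG .D (n + 2) j j = 2 := by
    simp [apaG_of_short (show j < n + 2 by omega) (Or.inr (show j + 1 < n + 2 by omega)), hs]
  have hjn := apaG_of_short (g := .D) (show j < n + 2 by omega) (Or.inr (show j + 1 < n + 2 by omega)) (n + 1)
  have hss : ∀ k, ipaG .D (n + 2) k n = _ := ipaG_of_short (Or.inr (by omega))
  simp only [CartanRel, aG, cstG, apaG_D_last, hjj, hjn, ipaG_D_last, hs, hss, lt_irrefl, if_false,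
    if_pos (show j + 1 < n + 1 + 1 by omega),
    if_pos (show n + 1 + 2 ≠ n + 2 by omega), Nat.add_sub_cancel,
    show n + 2 - 1 = n + 1 by omega]
  obtain rfl | hn' := eq_or_ne n j
  · constructor <;> refine ⟨0, ?_, ?_⟩ <;> simp
    all_goals field_simp
  rw [if_pos (show j + 2 ≠ n + 2 by omega)]
  obtain rfl | hn := eq_or_ne n (j + 1)
  · have h1 : ¬ j + 1 + 1 = j := by omega
    have h2 : ¬ j = j + 1 + 1 := by omega
    constructor
    · refine ⟨1, ?_, ?_⟩ <;> simp [h1, h2]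
      field_simp
    · refine ⟨1, ?_, ?_⟩ <;> simp [h1, h2]
      field_simp
  · have h1 : ¬ n + 1 = j := by omega
    have h2 : ¬ j = n + 1 := by omega
    constructor <;> refine ⟨0, ?_, ?_⟩ <;> simp [h1, h2, hn', hn'.symm, hn, hn.symm]

lemma cartanRel {ρ σ : K} (hρ : ρ ≠ 0) (hσ : σ ≠ 0) (g : GT) (n : ℕ) {i j : ℕ}
    (hi : i < rkOf g n) (hj : j < rkOf g n) (hij : i ≠ j) :
    CartanRel g (rkOf g n) ρ σ i j := by
  by_cases h : g = .A ∨ i + 1 < rkOf g n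
  · by_cases h' : g = .A ∨ j + 1 < rkOf g n
    · exact cartanRel_of_short hρ hσ hi hij h h'
    · cases g with
      | A => simp at h'
      | B =>
        simp only [rkOf, reduceCtorEq, false_or] at *
        obtain rfl : j = n := by omega
        exact (cartanRel_B_last hρ hσ (by omega)).2
      | C =>
        simp only [rkOf, reduceCtorEq, false_or] at *
        obtain rfl : j = n := by omega
        exact (cartanRel_C_last hρ hσ (by omega)).2
      | D =>
        simp only [rkOf, reduceCtorEq, false_or] at *
        obtain rfl : j = n + 1 := by omega
        exact (cartanRel_D_last hρ hσ (by omega)).2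
  · cases g with
    | A => simp at h
    | B =>
      simp only [rkOf, reduceCtorEq, false_or] at *
      obtain rfl : i = n := by omega
      exact (cartanRel_B_last hρ hσ (by omega)).1
    | C =>
      simp only [rkOf, reduceCtorEq, false_or] at *
      obtain rfl : i = n := by omega
      exact (cartanRel_C_last hρ hσ (by omega)).1
    | D =>
      simp only [rkOf, reduceCtorEq, false_or] at *
      obtain rfl : i = n + 1 := by omega
      exact (cartanRel_D_last hρ hσ (by omega)).1

end StructureConstants

section Triangular

variable {A : Type*} [Ring A] [Algebra K A]

open Subalgebra in
/-- The product of the three subalgebras spans the whole algebra. -/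
lemma IsRep.mul_mul_eq_top {I : Type*} [DecidableEq I] {q : I → I → K} (hq : ∀ i j, q i j ≠ 0)
    {c : I → K} {κ : I → I → ℕ} {e f : I → A} {t : TGen I → A} (hR : IsRep q c κ e f t)
    (htop : Algebra.adjoin K (Set.range e ∪ Set.range f ∪ Set.range t) = ⊤) :
    toSubmodule (Algebra.adjoin K (Set.range f)) * toSubmodule (Algebra.adjoin K (Set.range t)) *
      toSubmodule (Algebra.adjoin K (Set.range e)) = ⊤ := by
  set M := Algebra.adjoin K (Set.range f)
  set T := Algebra.adjoin K (Set.range t)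
  set P := Algebra.adjoin K (Set.range e)
  have hf : ∀ i, f i ∈ toSubmodule M := fun i ↦ Algebra.subset_adjoin ⟨i, rfl⟩
  have ht : ∀ x, t x ∈ toSubmodule T := fun x ↦ Algebra.subset_adjoin ⟨x, rfl⟩
  have he : ∀ i, e i ∈ toSubmodule P := fun i ↦ Algebra.subset_adjoin ⟨i, rfl⟩
  have hM1 : 1 ∈ toSubmodule M := M.one_mem
  have hT1 : 1 ∈ toSubmodule T := T.one_mem
  have hP1 : 1 ∈ toSubmodule P := P.one_mem
  have left : ∀ {B : Subalgebra K A} {S : Submodule K A} {b v : A}, b ∈ toSubmodule B →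
      v ∈ toSubmodule B * S → b * v ∈ toSubmodule B * S := fun {B S b v} hb hv ↦ by
    have := Submodule.mul_mem_mul hb hv
    rwa [← mul_assoc, (isIdempotentElem_toSubmodule B).eq] at this
  have right : ∀ {B : Subalgebra K A} {S : Submodule K A} {b v : A}, b ∈ toSubmodule B →
      v ∈ S * toSubmodule B → v * b ∈ S * toSubmodule B := fun {B S b v} hb hv ↦ by
    have := Submodule.mul_mem_mul hv hb
    rwa [mul_assoc, (isIdempotentElem_toSubmodule B).eq] at this
  have hMT : ∀ x, ∀ y ∈ toSubmodule M, t x * y ∈ toSubmodule M * toSubmodule T := by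
    intro x
    refine adjoin_le_of_mul_mem
      ((toSubmodule M * toSubmodule T).comap (LinearMap.mulLeft K (t x))) ?_ ?_
    · simpa using Submodule.mul_mem_mul hM1 (ht x)
    · rintro _ ⟨i, rfl⟩ y hy
      rw [Submodule.mem_comap, LinearMap.mulLeft_apply, ← mul_assoc, hR.tf, smul_mul_assoc, mul_assoc]
      exact Submodule.smul_mem _ _ (left (hf i) hy)
  have hTP : ∀ i, ∀ h ∈ toSubmodule T, e i * h ∈ toSubmodule T * toSubmodule P := by
    intro i
    refine adjoin_le_of_mul_mem
      ((toSubmodule T * toSubmodule P).comap (LinearMap.mulLeft K (e i))) ?_ ?_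
    · simpa using Submodule.mul_mem_mul hT1 (he i)
    · rintro _ ⟨x, rfl⟩ h hh
      have : e i * t x = (x.wt q i)⁻¹ • (t x * e i) := by
        rw [hR.te, smul_smul, inv_mul_cancel₀ (TGen.wt_ne_zero hq x i), one_smul]
      rw [Submodule.mem_comap, LinearMap.mulLeft_apply, ← mul_assoc, this, smul_mul_assoc, mul_assoc]
      exact Submodule.smul_mem _ _ (left (ht x) hh)
  have hcomm : ∀ i, ∀ y ∈ toSubmodule M,
      e i * y - y * e i ∈ toSubmodule M * toSubmodule T := by
    intro i y hy
    refine (adjoin_le_of_mul_mem (toSubmodule M ⊓ (toSubmodule M * toSubmodule T).comap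
      (LinearMap.mulLeft K (e i) - LinearMap.mulRight K (e i))) ⟨hM1, by simp⟩ ?_ hy).2
    · rintro _ ⟨j, rfl⟩ y ⟨hyM, hy⟩
      refine ⟨M.mul_mem (hf j) hyM, ?_⟩
      rw [SetLike.mem_coe, Submodule.mem_comap, LinearMap.sub_apply, LinearMap.mulLeft_apply,
        LinearMap.mulRight_apply] at hy ⊢
      have : e i * (f j * y) - f j * y * e i
          = f j * (e i * y - y * e i) + (e i * f j - f j * e i) * y := by noncomm_ring
      rw [this, hR.ef]
      refine add_mem (left (hf j) hy) ?_
      split_ifs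
      · rw [smul_mul_assoc, sub_mul]
        exact Submodule.smul_mem _ _ (sub_mem (hMT _ _ hyM) (hMT _ _ hyM))
      · simp
  refine submodule_eq_top htop _ ?_ ?_
  · simpa using Submodule.mul_mem_mul (Submodule.mul_mem_mul hM1 hT1) hP1
  · rintro _ ((⟨i, rfl⟩ | ⟨i, rfl⟩) | ⟨x, rfl⟩) z hz
    · induction hz using Submodule.mul_induction_on' with
      | add a _ b _ ha hb => rw [mul_add]; exact add_mem ha hb
      | mem_mul_mem v hv p hp =>
        induction hv using Submodule.mul_induction_on' with
        | add a _ b _ ha hb => rw [add_mul, mul_add]; exact add_mem ha hb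
        | mem_mul_mem y hy h hh =>
          have : e i * (y * h * p) = y * (e i * h * p) + (e i * y - y * e i) * h * p := by
            noncomm_ring
          rw [this]
          refine add_mem ?_ (Submodule.mul_mem_mul (right hh (hcomm i y hy)) hp)
          rw [mul_assoc (toSubmodule M)]
          exact Submodule.mul_mem_mul hy (right hp (hTP i h hh))
    · rw [mul_assoc] at hz ⊢
      exact left (hf i) hz
    · induction hz using Submodule.mul_induction_on' with
      | add a _ b _ ha hb => rw [mul_add]; exact add_mem ha hb
      | mem_mul_mem v hv p hp =>
        rw [← mul_assoc]
        refine Submodule.mul_mem_mul ?_ hp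
        induction hv using Submodule.mul_induction_on' with
        | add a _ b _ ha hb => rw [mul_add]; exact add_mem ha hb
        | mem_mul_mem y hy h hh =>
          rw [← mul_assoc]
          exact right hh (hMT x y hy)

/-- A homomorphism to an endomorphism algebra that acts on the image of a linear map as left
multiplication is determined on generators. -/
lemma apply_apply_of_adjoin_eq_top {B V : Type*} [Ring B] [Algebra K B] [AddCommGroup V]
    [Module K V] {s : Set B} (hs : Algebra.adjoin K s = ⊤) (Φ : B →ₐ[K] Module.End K V)
    (L : B →ₗ[K] V) (h : ∀ a ∈ s, ∀ b, Φ a (L b) = L (a * b)) (a b : B) :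
    Φ a (L b) = L (a * b) := by
  have ha : a ∈ Algebra.adjoin K s := hs ▸ Algebra.mem_top
  induction ha using Algebra.adjoin_induction generalizing b with
  | mem a ha => exact h a ha b
  | algebraMap r => simp [Module.algebraMap_end_apply, ← Algebra.smul_def]
  | add a a' _ _ iha iha' => rw [map_add, LinearMap.add_apply, iha, iha', add_mul, map_add]
  | mul a a' _ _ iha iha' => rw [map_mul, Module.End.mul_apply, iha', iha, mul_assoc]

lemma exists_algHom_of_range_eq {B : Type*} [Ring B] [Algebra K B] {φ : B →ₐ[K] A}
    {S : Subalgebra K A} (h : φ.range = S) :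
    ∃ ψ : B →ₐ[K] S, Function.Surjective ψ ∧ ∀ b, (ψ b : A) = φ b := by
  subst h
  exact ⟨φ.rangeRestrict, φ.rangeRestrict_surjective, fun _ ↦ rfl⟩

lemma range_eq_adjoin_range {B ι : Type*} [Ring B] [Algebra K B] {φ : B →ₐ[K] A} {b : ι → B}
    (hb : Algebra.adjoin K (Set.range b) = ⊤) {a : ι → A} (h : ∀ i, φ (b i) = a i) :
    φ.range = Algebra.adjoin K (Set.range a) := by
  rw [← Algebra.map_top, ← hb, AlgHom.map_adjoin, ← Set.range_comp]
  congr 2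
  exact funext h

end Triangular

section Main

variable {ρ σ : K}

lemma one_le_toNat (hρ : ρ ≠ 0) (hσ : σ ≠ 0) (g : GT) (n : ℕ)
    (i j : Fin (rkOf g n)) (hij : i ≠ j) :
    1 ≤ (1 - aG g (rkOf g n) i j).toNat := by
  obtain ⟨k, hk, -⟩ := cartanRel hρ hσ g n i.2 j.2 (fun h ↦ hij (Fin.ext h))
  omega

lemma serreExp_identity (hρ : ρ ≠ 0) (hσ : σ ≠ 0) (g : GT) (n : ℕ)
    (i j : Fin (rkOf g n)) (hij : i ≠ j) :
    cstG g (rkOf g n) ρ σ i j * cstG g (rkOf g n) ρ σ j i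
      * cstG g (rkOf g n) ρ σ i i ^ serreExp g n i j = 1 := by
  obtain ⟨k, hk, h⟩ := cartanRel hρ hσ g n i.2 j.2 (fun h ↦ hij (Fin.ext h))
  rwa [serreExp, show (1 - aG g (rkOf g n) i j).toNat - 1 = k by omega]

lemma adjoin_range_genG (g : GT) (n : ℕ) :
    Algebra.adjoin K (Set.range (genG (g := g) (n := n) ρ σ)) = ⊤ := by
  have h : Set.range (genG (g := g) (n := n) ρ σ)
      = RingQuot.mkAlgHom K (RelG g n ρ σ) '' Set.range (FreeAlgebra.ι K) := by
    rw [← Set.range_comp]; rfl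
  rw [h, ← AlgHom.map_adjoin, FreeAlgebra.adjoin_range_ι, Algebra.map_top, AlgHom.range_eq_top]
  exact RingQuot.mkAlgHom_surjective K _

lemma range_genG (g : GT) (n : ℕ) : Set.range (genG (g := g) (n := n) ρ σ)
    = Set.range (fun i ↦ genG ρ σ (.e i)) ∪ Set.range (fun i ↦ genG ρ σ (.f i)) ∪
      Set.range (fun x ↦ genG ρ σ (TGen.toGen x)) := by
  ext a
  constructor
  · rintro ⟨x, rfl⟩
    cases x with
    | e i => exact .inl (.inl ⟨i, rfl⟩)
    | f i => exact .inl (.inr ⟨i, rfl⟩)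
    | w i => exact .inr ⟨.w i, rfl⟩
    | winv i => exact .inr ⟨.winv i, rfl⟩
    | wp i => exact .inr ⟨.wp i, rfl⟩
    | wpinv i => exact .inr ⟨.wpinv i, rfl⟩
  · rintro ((⟨x, rfl⟩ | ⟨x, rfl⟩) | ⟨x, rfl⟩) <;> exact ⟨_, rfl⟩

lemma range_toGen (g : GT) (n : ℕ) :
    Set.range (fun x ↦ genG (g := g) (n := n) ρ σ (TGen.toGen x))
    = (Set.range fun i : Fin (rkOf g n) => genG ρ σ (Gen.w i)) ∪
     (Set.range fun i : Fin (rkOf g n) => genG ρ σ (Gen.winv i)) ∪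
     (Set.range fun i : Fin (rkOf g n) => genG ρ σ (Gen.wp i)) ∪
     (Set.range fun i : Fin (rkOf g n) => genG ρ σ (Gen.wpinv i)) := by
  ext a
  constructor
  · rintro ⟨x, rfl⟩
    cases x with
    | w i => exact .inl (.inl (.inl ⟨i, rfl⟩))
    | winv i => exact .inl (.inl (.inr ⟨i, rfl⟩))
    | wp i => exact .inl (.inr ⟨i, rfl⟩)
    | wpinv i => exact .inr ⟨i, rfl⟩
  · rintro (((⟨i, rfl⟩ | ⟨i, rfl⟩) | ⟨i, rfl⟩) | ⟨i, rfl⟩)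
    exacts [⟨.w i, rfl⟩, ⟨.winv i, rfl⟩, ⟨.wp i, rfl⟩, ⟨.wpinv i, rfl⟩]

open SerreAlg in
/-- The three factors of the triangular decomposition are images of abstract algebras, compatibly
with the representation on their tensor product. -/
lemma exists_triangular (hρ : ρ ≠ 0) (hσ : σ ≠ 0) (g : GT) (n : ℕ) :
    ∃ (φ₁ : SerreAlg (fun i j : Fin (rkOf g n) ↦ cstG g (rkOf g n) ρ σ j i) (serreExp g n)
        →ₐ[K] UG K g n ρ σ)
      (φ₂ : Torus K (Fin (rkOf g n)) →ₐ[K] UG K g n ρ σ)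
      (φ₃ : SerreAlg (fun i j : Fin (rkOf g n) ↦ cstG g (rkOf g n) ρ σ i j) (serreExp g n)
        →ₐ[K] UG K g n ρ σ)
      (E : UG K g n ρ σ →ₗ[K]
        SerreAlg (fun i j : Fin (rkOf g n) ↦ cstG g (rkOf g n) ρ σ j i) (serreExp g n) ⊗[K]
        (Torus K (Fin (rkOf g n)) ⊗[K]
          SerreAlg (fun i j : Fin (rkOf g n) ↦ cstG g (rkOf g n) ρ σ i j) (serreExp g n))),
      φ₁.range = Algebra.adjoin K (Set.range fun i ↦ genG ρ σ (.f i)) ∧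
      φ₂.range = Algebra.adjoin K (Set.range fun x ↦ genG ρ σ (TGen.toGen x)) ∧
      φ₃.range = Algebra.adjoin K (Set.range fun i ↦ genG ρ σ (.e i)) ∧
      ∀ y h x, E (φ₁ y * φ₂ h * φ₃ x) = y ⊗ₜ[K] (h ⊗ₜ[K] x) := by
  set q := fun i j : Fin (rkOf g n) ↦ cstG g (rkOf g n) ρ σ i j
  have hq : ∀ i j, q i j ≠ 0 := fun i j ↦ cstG_ne_zero hρ hσ _ _ _ _
  have ha := one_le_toNat hρ hσ g n
  have hG := genG_isRep (g := g) (n := n) ρ σ hq ha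
  obtain ⟨e, f, t, hR, he, ht, hf⟩ := exists_isRep (q := q)
    (c := fun i ↦ (riG g (rkOf g n) ρ i - riG g (rkOf g n) σ i)⁻¹) hq
    (serreExp_identity hρ hσ g n)
  obtain ⟨Ψ, hΨe, hΨf, hΨt⟩ := hR.exists_algHom ρ σ hq ha
  let φ₁ : SerreAlg (fun i j ↦ q j i) (serreExp g n) →ₐ[K] UG K g n ρ σ :=
    SerreAlg.lift (fun i ↦ genG ρ σ (.f i)) hG.serre_f
  let φ₂ : Torus K (Fin (rkOf g n)) →ₐ[K] UG K g n ρ σ :=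
    Torus.lift (fun x ↦ genG ρ σ x.toGen) hG.comm hG.mul_inv
  let φ₃ : SerreAlg q (serreExp g n) →ₐ[K] UG K g n ρ σ :=
    SerreAlg.lift (fun i ↦ genG ρ σ (.e i)) hG.serre_e
  have h₁ : ∀ i, φ₁ (gen _ _ i) = genG ρ σ (.f i) := SerreAlg.lift_gen _ _
  have h₂ : ∀ x, φ₂ (Torus.gen K x) = genG ρ σ x.toGen := Torus.lift_gen _ _ _
  have h₃ : ∀ i, φ₃ (gen _ _ i) = genG ρ σ (.e i) := SerreAlg.lift_gen _ _
  refine ⟨φ₁, φ₂, φ₃, LinearMap.applyₗ (1 ⊗ₜ[K] (1 ⊗ₜ[K] 1)) ∘ₗ Ψ.toLinearMap,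
    range_eq_adjoin_range adjoin_range_gen h₁, range_eq_adjoin_range Torus.adjoin_range_gen h₂,
    range_eq_adjoin_range adjoin_range_gen h₃, fun y h x ↦ ?_⟩
  have H₁ := apply_apply_of_adjoin_eq_top adjoin_range_gen (Ψ.comp φ₁)
    ((TensorProduct.mk K _ _).flip (h ⊗ₜ[K] x)) (by
      rintro _ ⟨i, rfl⟩ b
      rw [AlgHom.comp_apply, h₁, hΨf]
      exact hf i b _) y 1
  have H₂ := apply_apply_of_adjoin_eq_top Torus.adjoin_range_gen (Ψ.comp φ₂)
    ((TensorProduct.mk K (SerreAlg (fun i j ↦ q j i) (serreExp g n)) _ 1) ∘ₗ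
      (TensorProduct.mk K _ _).flip x) (by
      rintro _ ⟨i, rfl⟩ b
      rw [AlgHom.comp_apply, h₂, hΨt]
      exact ht i b _) h 1
  have H₃ := apply_apply_of_adjoin_eq_top adjoin_range_gen (Ψ.comp φ₃)
    ((TensorProduct.mk K (SerreAlg (fun i j ↦ q j i) (serreExp g n)) _ 1) ∘ₗ
      (TensorProduct.mk K (Torus K (Fin (rkOf g n))) _ 1)) (by
      rintro _ ⟨i, rfl⟩ b
      rw [AlgHom.comp_apply, h₃, hΨe]
      exact he i b) x 1
  change Ψ (φ₁ y * φ₂ h * φ₃ x) (1 ⊗ₜ[K] (1 ⊗ₜ[K] 1)) = _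
  rw [_root_.map_mul, _root_.map_mul]
  change Ψ (φ₁ y) (Ψ (φ₂ h) (Ψ (φ₃ x) (1 ⊗ₜ[K] (1 ⊗ₜ[K] 1)))) = _
  change Ψ (φ₃ x) (1 ⊗ₜ[K] (1 ⊗ₜ[K] 1)) = 1 ⊗ₜ[K] (1 ⊗ₜ[K] (x * 1)) at H₃
  change Ψ (φ₂ h) (1 ⊗ₜ[K] (1 ⊗ₜ[K] x)) = 1 ⊗ₜ[K] ((h * 1) ⊗ₜ[K] x) at H₂
  change Ψ (φ₁ y) (1 ⊗ₜ[K] (h ⊗ₜ[K] x)) = (y * 1) ⊗ₜ[K] (h ⊗ₜ[K] x) at H₁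
  rw [mul_one] at H₁ H₂ H₃
  rw [H₃, H₂, H₁]

end Main

section Rational

lemma qr_ne_zero : qr ≠ 0 := by
  rw [qr, Ne, FaithfulSMul.algebraMap_eq_zero_iff]
  exact MvPolynomial.X_ne_zero 0

lemma qs_ne_zero : qs ≠ 0 := by
  rw [qs, Ne, FaithfulSMul.algebraMap_eq_zero_iff]
  exact MvPolynomial.X_ne_zero 1

variable (g : GT) (n : ℕ)

lemma U0Sub_eq_adjoin :
    U0Sub g n = Algebra.adjoin KK (Set.range fun x ↦ genG qr qs (TGen.toGen x)) := by
  rw [U0Sub, range_toGen]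

lemma triMap_tmul (x : NmSub g n) (h : U0Sub g n) (y : NpSub g n) :
    triMap g n ((x ⊗ₜ[KK] h) ⊗ₜ[KK] y) = (x : UG KK g n qr qs) * h * y :=
  rfl

lemma triMap_surjective : Function.Surjective (triMap g n) := by
  have hG := genG_isRep (g := g) (n := n) qr qs
    (fun i j ↦ cstG_ne_zero qr_ne_zero qs_ne_zero _ _ _ _)
    (one_le_toNat qr_ne_zero qs_ne_zero g n)
  have htop := hG.mul_mul_eq_top (fun i j ↦ cstG_ne_zero qr_ne_zero qs_ne_zero _ _ _ _)
    (by rw [← range_genG, adjoin_range_genG])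
  rw [← LinearMap.range_eq_top, ← top_le_iff, ← htop, ← U0Sub_eq_adjoin, Submodule.mul_le]
  intro v hv y hy
  induction hv using Submodule.mul_induction_on' with
  | add a _ b _ ha hb => rw [add_mul]; exact add_mem ha hb
  | mem_mul_mem x hx h hh =>
    exact ⟨((⟨x, hx⟩ : NmSub g n) ⊗ₜ[KK] (⟨h, hh⟩ : U0Sub g n)) ⊗ₜ[KK] (⟨y, hy⟩ : NpSub g n), rfl⟩

lemma triMap_injective : Function.Injective (triMap g n) := by
  obtain ⟨φ₁, φ₂, φ₃, E, h₁, h₂, h₃, hE⟩ := exists_triangular qr_ne_zero qs_ne_zero g n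
  rw [← U0Sub_eq_adjoin] at h₂
  obtain ⟨ψ₁, hs₁, hψ₁⟩ := exists_algHom_of_range_eq (S := NmSub g n) h₁
  obtain ⟨ψ₂, hs₂, hψ₂⟩ := exists_algHom_of_range_eq h₂
  obtain ⟨ψ₃, hs₃, hψ₃⟩ := exists_algHom_of_range_eq (S := NpSub g n) h₃
  let P := TensorProduct.map (TensorProduct.map ψ₁.toLinearMap ψ₂.toLinearMap) ψ₃.toLinearMap
  have hP : Function.Surjective P :=
    TensorProduct.map_surjective (TensorProduct.map_surjective hs₁ hs₂) hs₃
  have key : E ∘ₗ triMap g n ∘ₗ P = (TensorProduct.assoc KK _ _ _).toLinearMap := by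
    refine TensorProduct.ext_threefold fun y h x ↦ ?_
    change E ((ψ₁ y : UG KK g n qr qs) * ψ₂ h * ψ₃ x) = y ⊗ₜ[KK] (h ⊗ₜ[KK] x)
    rw [hψ₁, hψ₂, hψ₃, hE]
  have key' : Function.Injective ((triMap g n) ∘ P) := by
    refine Function.Injective.of_comp (f := E) ?_
    have : E ∘ triMap g n ∘ P = TensorProduct.assoc KK _ _ _ := congrArg DFunLike.coe key
    rw [this]
    exact LinearEquiv.injective _
  exact (Function.Injective.of_comp_iff' _ ⟨key'.of_comp, hP⟩).1 key'

end Rational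

end TriDec

theorem stmt8 (g : GT) (n : ℕ) :
    (∀ (x : ↥(NmSub g n)) (h : ↥(U0Sub g n)) (y : ↥(NpSub g n)),
      triMap g n ((x ⊗ₜ[KK] h) ⊗ₜ[KK] y) = (x : UG KK g n qr qs) * h * y) ∧
    Function.Bijective (triMap g n) := by
  exact ⟨TriDec.triMap_tmul g n, TriDec.triMap_injective g n, TriDec.triMap_surjective g n⟩

end

end
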